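/- arXiv:1409.6134 — 2 statements merged into one kernel-verified Lean document; each statement's English description precedes it below -/
import Mathlib

section
/- Let T be an ergodic automorphism of a standard probability space (X,μ), and let ρ and ρ̃ be two summable admissible semimetrics on (X,μ) that are both generating for (X,μ,T). Then the classes of scaling sequences coincide: ℋ(X,μ,T,ρ) = ℋ(X,μ,T,ρ̃). -/
open MeasureTheory Filter Set
open scoped ENNReal

/-- A semimetric on a set: symmetric, nonnegative, vanishing on the diagonal,
satisfying the triangle inequality. -/
structure IsSemimetric {Y : Type*} (ρ : Y → Y → ℝ) : Prop where
  refl : ∀ x, ρ x x = 0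
  symm : ∀ x y, ρ x y = ρ y x
  nonneg : ∀ x y, 0 ≤ ρ x y
  triangle : ∀ x y z, ρ x z ≤ ρ x y + ρ y z

/-- `ρ` is separable on the set `s`: some countable subset of `s` is `ρ`-dense in `s`. -/
def SeparableWRT {Y : Type*} (ρ : Y → Y → ℝ) (s : Set Y) : Prop :=
  ∃ D : Set Y, D.Countable ∧ D ⊆ s ∧ ∀ x ∈ s, ∀ ε : ℝ, 0 < ε → ∃ y ∈ D, ρ x y < ε

variable {X : Type*} [MeasurableSpace X]

/-- A semimetric is admissible if it is separable on a measurable subset of full measure. -/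
def IsAdmissible (μ : Measure X) (ρ : X → X → ℝ) : Prop :=
  ∃ s : Set X, MeasurableSet s ∧ μ sᶜ = 0 ∧ SeparableWRT ρ s

/-- There is a partition `X₀, X₁, …, X_k` of `X` into measurable pieces with `μ X₀ < ε`
and the `ρ`-diameter of `X_j` (1 ≤ j ≤ k) less than `ε`. -/
def IsEntropyPartition (μ : Measure X) (ρ : X → X → ℝ) (ε : ℝ) (k : ℕ) : Prop :=
  ∃ P : Fin (k + 1) → Set X,
    (∀ j, MeasurableSet (P j)) ∧
    Pairwise (fun i j => Disjoint (P i) (P j)) ∧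
    (⋃ j, P j) = Set.univ ∧
    μ (P 0) < ENNReal.ofReal ε ∧
    ∀ j, j ≠ 0 → ∀ x ∈ P j, ∀ y ∈ P j, ρ x y < ε

open scoped Classical in
/-- The Kolmogorov ε-entropy `ℍ_ε(X, μ, ρ)` of a semimetric triple: `log₂ k` for the least
`k` admitting an entropy partition, and `∞` if there is none. -/
noncomputable def epsEntropy (μ : Measure X) (ρ : X → X → ℝ) (ε : ℝ) : ℝ≥0∞ :=
  if h : ∃ k, IsEntropyPartition μ ρ ε k
  then ENNReal.ofReal (Real.logb 2 (Nat.find h))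
  else ⊤

/-- The shift `T^k ρ` of a semimetric by the `k`-th power (k ∈ ℤ) of an automorphism. -/
def shiftSemimetric (T : Equiv.Perm X) (k : ℤ) (ρ : X → X → ℝ) : X → X → ℝ :=
  fun x y => ρ ((T ^ k) x) ((T ^ k) y)

/-- The average `T^n_av ρ = (1/n) ∑_{k=0}^{n-1} T^k ρ`. -/
noncomputable def avgSemimetric (T : Equiv.Perm X) (ρ : X → X → ℝ) (n : ℕ) : X → X → ℝ :=
  fun x y => (∑ k ∈ Finset.range n, ρ ((T ^ k) x) ((T ^ k) y)) / n

/-- `h` is a scaling sequence for the semimetric `ρ` w.r.t. the automorphism `T`: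
`h` is positive, for every `ε > 0` the sequence `ℍ_ε(X, μ, T^n_av ρ)/h_n` has finite limsup,
and for all sufficiently small `ε > 0` it has positive liminf. Sequences are indexed by
`n = 1, 2, …`. -/
def IsScalingSeq (μ : Measure X) (T : Equiv.Perm X) (ρ : X → X → ℝ) (h : ℕ → ℝ) : Prop :=
  (∀ n, 1 ≤ n → 0 < h n) ∧
  (∀ ε : ℝ, 0 < ε →
    Filter.limsup (fun n : ℕ =>
      epsEntropy μ (avgSemimetric T ρ n) ε / ENNReal.ofReal (h n)) Filter.atTop < ⊤) ∧
  (∃ ε₀ : ℝ, 0 < ε₀ ∧ ∀ ε : ℝ, 0 < ε → ε < ε₀ →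
    0 < Filter.liminf (fun n : ℕ =>
      epsEntropy μ (avgSemimetric T ρ n) ε / ENNReal.ofReal (h n)) Filter.atTop)

/-- `ρ` is (two-sided) generating for `(X, μ, T)`: the shifts `T^k ρ`, `k ∈ ℤ`, separate points
of a subset of full measure. -/
def IsGenerating (μ : Measure X) (T : Equiv.Perm X) (ρ : X → X → ℝ) : Prop :=
  ∃ s : Set X, MeasurableSet s ∧ μ sᶜ = 0 ∧
    ∀ x ∈ s, ∀ y ∈ s, x ≠ y → ∃ k : ℤ, 0 < ρ ((T ^ k) x) ((T ^ k) y)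

/-- `h` is a scaling entropy sequence of the system `(X, μ, T)`: it is a scaling sequence for
some summable admissible measurable generating semimetric. -/
def IsScalingEntropySeq (μ : Measure X) (T : Equiv.Perm X) (h : ℕ → ℝ) : Prop :=
  ∃ ρ : X → X → ℝ, IsSemimetric ρ ∧
    Measurable (fun p : X × X => ρ p.1 p.2) ∧
    MeasureTheory.Integrable (fun p : X × X => ρ p.1 p.2) (μ.prod μ) ∧
    IsAdmissible μ ρ ∧ IsGenerating μ T ρ ∧ IsScalingSeq μ T ρ h

/-- The (Shannon) entropy, base 2, of the countable partition of `X` into the fibers of `f`. -/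
noncomputable def partitionEntropy {ι : Type*} [Countable ι] (μ : Measure X) (f : X → ι) :
    ℝ≥0∞ :=
  ∑' i : ι, ENNReal.ofReal (-((μ (f ⁻¹' {i})).toReal * Real.logb 2 (μ (f ⁻¹' {i})).toReal))

/-- The Kolmogorov (measure-theoretic) entropy of the automorphism `T`: the supremum over all
finite measurable partitions `ξ` of `lim_n H(ξ ∨ T⁻¹ξ ∨ ⋯ ∨ T^{-(n-1)}ξ)/n`. -/
noncomputable def kolmogorovEntropy (μ : Measure X) (T : Equiv.Perm X) : ℝ≥0∞ :=
  ⨆ (m : ℕ) (ξ : X → Fin m) (_ : ∀ i, MeasurableSet (ξ ⁻¹' {i})),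
    Filter.limsup (fun n : ℕ =>
      partitionEntropy μ (fun x => fun i : Fin n => ξ ((T ^ (-(i : ℤ))) x)) / (n : ℝ≥0∞))
      Filter.atTop

/-- The Kushnirenko `A`-entropy of `T` along the sequence `A = {a_n}`: the supremum over all
countable measurable partitions `ξ` of finite entropy of
`limsup_n H(T^{a_1}ξ ∨ ⋯ ∨ T^{a_n}ξ)/n`. -/
noncomputable def kushnirenkoEntropy (μ : Measure X) (T : Equiv.Perm X) (a : ℕ → ℕ) : ℝ≥0∞ :=
  ⨆ (ξ : X → ℕ) (_ : ∀ i, MeasurableSet (ξ ⁻¹' {i})) (_ : partitionEntropy μ ξ < ⊤),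
    Filter.limsup (fun n : ℕ =>
      partitionEntropy μ (fun x => fun i : Fin n => ξ ((T ^ (a i)) x)) / (n : ℝ≥0∞))
      Filter.atTop

/-- The Koopman operator `f ↦ f ∘ T` on `L²(X, μ)` has purely point spectrum: `L²(X, μ)`
possesses an orthonormal (Hilbert) basis consisting of eigenfunctions of `f ↦ f ∘ T`. -/
def HasPurePointSpectrum (μ : Measure X) (T : X → X) : Prop :=
  ∃ (ι : Type) (b : HilbertBasis ι ℂ (MeasureTheory.Lp ℂ 2 μ)),
    ∀ i : ι, ∃ c : ℂ, (fun x => (b i : MeasureTheory.Lp ℂ 2 μ) (T x))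
      =ᵐ[μ] fun x => c * (b i : MeasureTheory.Lp ℂ 2 μ) x

lemma aux_mp (μ : Measure X) (T : Equiv.Perm X) (hT : MeasurePreserving (⇑T) μ μ)
    (hTsymm : Measurable (⇑T.symm)) (k : ℤ) : MeasurePreserving (⇑(T ^ k)) μ μ := by
  have hs : MeasurePreserving (⇑T⁻¹) μ μ := by
    let e : X ≃ᵐ X := ⟨T, hT.measurable, hTsymm⟩
    exact MeasurePreserving.symm (e := e) hT
  have hp : ∀ (S : Equiv.Perm X), MeasurePreserving (⇑S) μ μ → ∀ n : ℕ,
      MeasurePreserving (⇑(S ^ n)) μ μ := by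
    intro S hS n
    rw [Equiv.Perm.coe_pow]
    exact hS.iterate n
  cases k with
  | ofNat n => simpa using hp T hT n
  | negSucc n =>
    rw [zpow_negSucc, ← inv_pow]
    exact hp _ hs _

lemma aux_compact {ι : Type*} (L₁ L₂ : Set (ι → ℝ)) (h₁ : IsCompact L₁) (h₂ : IsCompact L₂)
    (hd : Disjoint L₁ L₂) :
    ∃ t : Finset (ι × ℕ), ∀ z ∈ L₁, ∀ w ∈ L₂, ∃ p ∈ t, 1 / ((p.2 : ℝ) + 1) < |z p.1 - w p.1| := by
  have hc := h₁.prod h₂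
  obtain ⟨t, ht⟩ := hc.elim_finite_subcover
    (fun p : ι × ℕ => {q : (ι → ℝ) × (ι → ℝ) | 1 / ((p.2 : ℝ) + 1) < |q.1 p.1 - q.2 p.1|})
    (fun p => by
      apply isOpen_lt continuous_const
      fun_prop)
    (by
      rintro ⟨z, w⟩ ⟨hz, hw⟩
      have hne : z ≠ w := by
        rintro rfl
        exact Set.disjoint_left.1 hd hz hw
      obtain ⟨i, hi⟩ := Function.ne_iff.1 hne
      obtain ⟨n, hn⟩ := exists_nat_one_div_lt (abs_pos.2 (sub_ne_zero.2 hi))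
      exact Set.mem_iUnion.2 ⟨(i, n), hn⟩)
  refine ⟨t, fun z hz w hw => ?_⟩
  have := ht (Set.mk_mem_prod hz hw)
  simp only [Set.mem_iUnion] at this
  obtain ⟨p, hp, h⟩ := this
  exact ⟨p, hp, h⟩

lemma aux_meas_left {ρ : X → X → ℝ} (h : Measurable fun p : X × X => ρ p.1 p.2) (b : X) :
    Measurable fun x => ρ x b :=
  h.comp (measurable_id.prodMk measurable_const)

lemma aux_sep [StandardBorelSpace X] (μ : Measure X) [IsProbabilityMeasure μ]
    (T : Equiv.Perm X) (hmp : ∀ k : ℤ, MeasurePreserving (⇑(T ^ k)) μ μ)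
    (ρ : X → X → ℝ)
    (hρ : IsSemimetric ρ) (hρmeas : Measurable fun p : X × X => ρ p.1 p.2)
    (hρadm : IsAdmissible μ ρ) (hρgen : IsGenerating μ T ρ)
    (A : ℕ → Set X) (hA : ∀ i, MeasurableSet (A i)) (hAd : Pairwise (fun i j => Disjoint (A i) (A j)))
    (N : ℕ) (κ : ℝ≥0∞) (hκ : κ ≠ 0) :
    ∃ B : ℕ → Set X, (∀ i, MeasurableSet (B i)) ∧ (∀ i, B i ⊆ A i) ∧ (∀ i, μ (A i \ B i) ≤ κ) ∧
      ∃ (m : ℕ) (c : ℝ), 0 < c ∧ ∀ i < N, ∀ j < N, i ≠ j → ∀ x ∈ B i, ∀ y ∈ B j,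
        c ≤ ∑ k ∈ Finset.Icc (-(m : ℤ)) m, ρ ((T ^ k) x) ((T ^ k) y) := by
  obtain ⟨s, hsm, hs0, D, hDc, hDs, hD⟩ := hρadm
  obtain ⟨s', hs'm, hs'0, hs'⟩ := hρgen
  haveI : Countable D := hDc.to_subtype
  let Φ : X → (ℤ × D → ℝ) := fun x p => ρ ((T ^ p.1) x) p.2
  have hΦ : Measurable Φ :=
    measurable_pi_lambda _ fun p => (aux_meas_left hρmeas (p.2 : X)).comp (hmp p.1).measurable
  let X' : Set X := s' ∩ ⋂ k : ℤ, (⇑(T ^ k)) ⁻¹' s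
  have hX'm : MeasurableSet X' :=
    hs'm.inter (MeasurableSet.iInter fun k => (hmp k).measurable hsm)
  have hX'0 : μ X'ᶜ = 0 := by
    have : X'ᶜ = s'ᶜ ∪ ⋃ k : ℤ, (⇑(T ^ k)) ⁻¹' sᶜ := by
      simp only [X', Set.compl_inter, Set.compl_iInter, Set.preimage_compl]
    rw [this]
    refine measure_union_null hs'0 (measure_iUnion_null fun k => ?_)
    rw [(hmp k).measure_preimage hsm.compl.nullMeasurableSet, hs0]
  have hinj : Set.InjOn Φ X' := by
    intro x hx y hy hxy
    by_contra hne
    obtain ⟨k, hk⟩ := hs' x hx.1 y hy.1 hne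
    have hxs : (T ^ k) x ∈ s := Set.mem_iInter.1 hx.2 k
    obtain ⟨d, hdD, hd⟩ := hD _ hxs (ρ ((T ^ k) x) ((T ^ k) y) / 2) (by linarith)
    have h1 : ρ ((T ^ k) x) d = ρ ((T ^ k) y) d := congrFun hxy (k, ⟨d, hdD⟩)
    have h2 := hρ.triangle ((T ^ k) x) d ((T ^ k) y)
    rw [hρ.symm d] at h2
    linarith
  have hIm : ∀ i, MeasurableSet (Φ '' (A i ∩ X')) := fun i =>
    ((hA i).inter hX'm).image_of_measurable_injOn hΦ (hinj.mono Set.inter_subset_right)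
  let ν := μ.map Φ
  haveI : IsProbabilityMeasure ν := Measure.isProbabilityMeasure_map hΦ.aemeasurable
  have hex : ∀ i, ∃ L, L ⊆ Φ '' (A i ∩ X') ∧ IsCompact L ∧ ν (Φ '' (A i ∩ X') \ L) < κ :=
    fun i => (hIm i).exists_isCompact_diff_lt (measure_ne_top _ _) hκ
  choose L hLs hLc hLκ using hex
  have hLd : ∀ i j, i ≠ j → Disjoint (L i) (L j) := by
    intro i j hij
    rw [Set.disjoint_left]
    intro z hz hz'
    obtain ⟨x, hx, rfl⟩ := hLs i hz
    obtain ⟨y, hy, hxy⟩ := hLs j hz'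
    have := hinj hy.2 hx.2 hxy
    subst this
    exact Set.disjoint_left.1 (hAd hij) hx.1 hy.1
  have ht : ∀ i j, ∃ t : Finset ((ℤ × D) × ℕ), i ≠ j → ∀ z ∈ L i, ∀ w ∈ L j,
      ∃ p ∈ t, 1 / ((p.2 : ℝ) + 1) < |z p.1 - w p.1| := by
    intro i j
    by_cases hij : i = j
    · exact ⟨∅, fun h => absurd hij h⟩
    · obtain ⟨t, ht⟩ := aux_compact _ _ (hLc i) (hLc j) (hLd i j hij)
      exact ⟨t, fun _ => ht⟩
  choose t ht using ht
  classical
  let t' : Finset ((ℤ × D) × ℕ) :=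
    (Finset.range N).biUnion fun i => (Finset.range N).biUnion fun j => t i j
  let m : ℕ := t'.sup fun p => p.1.1.natAbs
  let n : ℕ := t'.sup fun p => p.2
  refine ⟨fun i => A i ∩ X' ∩ Φ ⁻¹' L i, fun i => ((hA i).inter hX'm).inter
    (hΦ (hLc i).measurableSet), fun i => fun x hx => hx.1.1, fun i => ?_,
    m, 1 / ((n : ℝ) + 1), by positivity, ?_⟩
  · have hsub : A i \ (A i ∩ X' ∩ Φ ⁻¹' L i) ⊆ X'ᶜ ∪ Φ ⁻¹' (Φ '' (A i ∩ X') \ L i) := by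
      rintro x ⟨hx, hnx⟩
      by_cases hxX : x ∈ X'
      · right
        exact ⟨⟨x, ⟨hx, hxX⟩, rfl⟩, fun h => hnx ⟨⟨hx, hxX⟩, h⟩⟩
      · left; exact hxX
    refine (measure_mono hsub).trans ((measure_union_le _ _).trans ?_)
    rw [hX'0, zero_add, ← Measure.map_apply hΦ ((hIm i).diff (hLc i).measurableSet)]
    exact (hLκ i).le
  · intro i hi j hj hij x hx y hy
    obtain ⟨p, hp, hlt⟩ := ht i j hij _ hx.2 _ hy.2
    have hpt : p ∈ t' := by
      simp only [t', Finset.mem_biUnion, Finset.mem_range]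
      exact ⟨i, hi, j, hj, hp⟩
    have hm : p.1.1.natAbs ≤ m := Finset.le_sup (f := fun p : (ℤ × D) × ℕ => p.1.1.natAbs) hpt
    have hn : p.2 ≤ n := Finset.le_sup (f := fun p : (ℤ × D) × ℕ => p.2) hpt
    have h1 : 1 / ((n : ℝ) + 1) ≤ 1 / ((p.2 : ℝ) + 1) := by
      apply one_div_le_one_div_of_le (by positivity)
      have : (p.2 : ℝ) ≤ n := by exact_mod_cast hn
      linarith
    have h2 : |Φ x p.1 - Φ y p.1| ≤ ρ ((T ^ p.1.1) x) ((T ^ p.1.1) y) := by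
      simp only [Φ]
      have e1 := hρ.triangle ((T ^ p.1.1) x) ((T ^ p.1.1) y) p.1.2
      have e2 := hρ.triangle ((T ^ p.1.1) y) ((T ^ p.1.1) x) p.1.2
      rw [hρ.symm ((T ^ p.1.1) y) ((T ^ p.1.1) x)] at e2
      rw [abs_le]
      constructor <;> linarith
    have h3 : ρ ((T ^ p.1.1) x) ((T ^ p.1.1) y) ≤
        ∑ k ∈ Finset.Icc (-(m : ℤ)) m, ρ ((T ^ k) x) ((T ^ k) y) := by
      apply Finset.single_le_sum (f := fun k : ℤ => ρ ((T ^ k) x) ((T ^ k) y))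
        (fun k _ => hρ.nonneg _ _)
      rw [Finset.mem_Icc]
      omega
    linarith

lemma aux_tail (μ : Measure X) (φ : X → ℝ) (hφm : Measurable φ)
    (hφ0 : ∀ x, 0 ≤ φ x) (hφ : Integrable φ μ) (κ : ℝ) (hκ : 0 < κ) :
    ∃ M : ℕ, ∫ x, {x | (M : ℝ) < φ x}.indicator φ x ∂μ < κ := by
  have : Tendsto (fun M : ℕ => ∫ x, {x | (M : ℝ) < φ x}.indicator φ x ∂μ) atTop
      (nhds (∫ _, (0 : ℝ) ∂μ)) := by
    refine tendsto_integral_of_dominated_convergence φ ?_ hφ ?_ ?_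
    · intro n
      exact (hφm.indicator (measurableSet_lt measurable_const hφm)).aestronglyMeasurable
    · intro n
      refine Eventually.of_forall fun x => ?_
      rw [Real.norm_eq_abs, abs_of_nonneg (Set.indicator_nonneg (fun x _ => hφ0 x) x)]
      exact Set.indicator_le_self' (fun x _ => hφ0 x) x
    · refine Eventually.of_forall fun x => ?_
      apply tendsto_const_nhds.congr'
      obtain ⟨n, hn⟩ := exists_nat_ge (φ x)
      filter_upwards [eventually_ge_atTop n] with k hk
      rw [Set.indicator_of_notMem]
      have : (n : ℝ) ≤ k := by exact_mod_cast hk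
      simp only [Set.mem_setOf_eq, not_lt]
      linarith
  rw [integral_zero] at this
  exact (this.eventually (gt_mem_nhds hκ)).exists

lemma aux_pieces (μ : Measure X) [IsProbabilityMeasure μ] (ρ : X → X → ℝ)
    (hρ : IsSemimetric ρ) (hρmeas : Measurable fun p : X × X => ρ p.1 p.2)
    (hρadm : IsAdmissible μ ρ) (η : ℝ) (hη : 0 < η) (κ : ℝ≥0∞) (hκ : κ ≠ 0) :
    ∃ A : ℕ → Set X, (∀ i, MeasurableSet (A i)) ∧ Pairwise (fun i j => Disjoint (A i) (A j)) ∧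
      (∀ i, ∀ x ∈ A i, ∀ y ∈ A i, ρ x y ≤ η) ∧ ∃ N, μ (⋃ i < N, A i)ᶜ ≤ κ := by
  obtain ⟨s, hsm, hs0, D, hDc, hDs, hD⟩ := hρadm
  have hsne : s.Nonempty := by
    by_contra h
    rw [Set.not_nonempty_iff_eq_empty] at h
    simp [h] at hs0
  have hDne : D.Nonempty := by
    obtain ⟨x, hx⟩ := hsne
    obtain ⟨y, hy, _⟩ := hD x hx 1 one_pos
    exact ⟨y, hy⟩
  obtain ⟨d, rfl⟩ := hDc.exists_eq_range hDne
  let W : ℕ → Set X := fun i => {x | ρ x (d i) < η / 2}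
  have hW : ∀ i, MeasurableSet (W i) := fun i =>
    measurableSet_lt (aux_meas_left hρmeas _) measurable_const
  have hAm : ∀ i, MeasurableSet (disjointed W i) := fun i => MeasurableSet.disjointed hW i
  refine ⟨disjointed W, hAm, fun i j hij => disjoint_disjointed W hij, ?_, ?_⟩
  · intro i x hx y hy
    have hx' : ρ x (d i) < η / 2 := disjointed_le W i hx
    have hy' : ρ y (d i) < η / 2 := disjointed_le W i hy
    have := hρ.triangle x (d i) y
    rw [hρ.symm (d i) y] at this
    linarith
  · have hcov : s ⊆ ⋃ i, disjointed W i := by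
      rw [iUnion_disjointed]
      intro x hx
      obtain ⟨y, ⟨i, rfl⟩, hy⟩ := hD x hx (η / 2) (by linarith)
      exact Set.mem_iUnion.2 ⟨i, hy⟩
    have hanti : Antitone fun N : ℕ => (⋃ i < N, disjointed W i)ᶜ := by
      intro a b hab
      apply Set.compl_subset_compl.2
      exact Set.biUnion_subset_biUnion_left fun i hi => lt_of_lt_of_le hi hab
    have hm : ∀ N : ℕ, MeasurableSet (⋃ i < N, disjointed W i)ᶜ := fun N =>
      (MeasurableSet.iUnion fun i => MeasurableSet.iUnion fun _ => hAm i).compl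
    have htd := tendsto_measure_iInter_atTop (μ := μ) (fun N => (hm N).nullMeasurableSet) hanti
      ⟨0, measure_ne_top _ _⟩
    have h0 : μ (⋂ N : ℕ, (⋃ i < N, disjointed W i)ᶜ) = 0 := by
      refine measure_mono_null ?_ hs0
      intro x hx hxs
      obtain ⟨i, hi⟩ := Set.mem_iUnion.1 (hcov hxs)
      have := Set.mem_iInter.1 hx (i + 1)
      exact this (Set.mem_iUnion₂.2 ⟨i, Nat.lt_succ_self i, hi⟩)
    rw [h0] at htd
    obtain ⟨N, hN⟩ := (htd.eventually (gt_mem_nhds (pos_iff_ne_zero.2 hκ))).exists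
    exact ⟨N, hN.le⟩

lemma aux_point (μ : Measure X) [IsProbabilityMeasure μ] (ρ : X → X → ℝ)
    (hρmeas : Measurable fun p : X × X => ρ p.1 p.2)
    (hρint : Integrable (fun p : X × X => ρ p.1 p.2) (μ.prod μ)) :
    ∃ b, Measurable (fun x => ρ x b) ∧ Integrable (fun x => ρ x b) μ := by
  obtain ⟨b, hb⟩ := hρint.prod_left_ae.exists
  exact ⟨b, aux_meas_left hρmeas b, hb⟩

lemma aux_key [StandardBorelSpace X] (μ : Measure X) [IsProbabilityMeasure μ]
    (T : Equiv.Perm X) (hmp : ∀ k : ℤ, MeasurePreserving (⇑(T ^ k)) μ μ)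
    (ρ ρ' : X → X → ℝ)
    (hρ : IsSemimetric ρ) (hρmeas : Measurable fun p : X × X => ρ p.1 p.2)
    (hρadm : IsAdmissible μ ρ) (hρgen : IsGenerating μ T ρ)
    (hρ' : IsSemimetric ρ') (hρ'meas : Measurable fun p : X × X => ρ' p.1 p.2)
    (hρ'int : MeasureTheory.Integrable (fun p : X × X => ρ' p.1 p.2) (μ.prod μ))
    (hρ'adm : IsAdmissible μ ρ') (η κ : ℝ) (hη : 0 < η) (hκ : 0 < κ) :
    ∃ (C : ℝ) (m : ℕ) (g : X → ℝ), 0 ≤ C ∧ Measurable g ∧ (∀ x, 0 ≤ g x) ∧ Integrable g μ ∧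
      ∫ x, g x ∂μ ≤ κ ∧ ∀ x y, ρ' x y ≤ η +
        C * ∑ k ∈ Finset.Icc (-(m : ℤ)) m, ρ ((T ^ k) x) ((T ^ k) y) + g x + g y := by
  obtain ⟨a, ham, hai⟩ := aux_point μ ρ' hρ'meas hρ'int
  obtain ⟨M, hM⟩ := aux_tail μ (fun x => ρ' x a) ham (fun x => hρ'.nonneg _ _) hai (κ / 4)
    (by linarith)
  set φ : X → ℝ := fun x => ρ' x a with hφ
  have hφ0 : ∀ x, 0 ≤ φ x := fun x => hρ'.nonneg _ _
  have hM0 : (0 : ℝ) ≤ M := Nat.cast_nonneg M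
  set κ' : ℝ := κ / (8 * (M + 1)) with hκ'
  have hκ'0 : 0 < κ' := by positivity
  obtain ⟨A, hAm, hAd, hAη, N, hN⟩ := aux_pieces μ ρ' hρ' hρ'meas hρ'adm η hη
    (ENNReal.ofReal κ') (by simpa using hκ'0)
  obtain ⟨B, hBm, hBA, hBκ, m, c, hc, hB⟩ := aux_sep μ T hmp ρ hρ hρmeas hρadm hρgen A hAm hAd N
    (ENNReal.ofReal (κ' / (N + 1))) (by
      have : 0 < κ' / (N + 1) := by positivity
      simpa using this)
  let U : Set X := ⋃ i < N, B i
  have hUm : MeasurableSet U := MeasurableSet.iUnion fun i => MeasurableSet.iUnion fun _ => hBm i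
  have hU : μ.real Uᶜ ≤ 2 * κ' := by
    have hsub : Uᶜ ⊆ (⋃ i < N, A i)ᶜ ∪ ⋃ i ∈ Finset.range N, (A i \ B i) := by
      intro x hx
      by_cases hxA : x ∈ ⋃ i < N, A i
      · right
        obtain ⟨i, hi, hxi⟩ := Set.mem_iUnion₂.1 hxA
        refine Set.mem_iUnion₂.2 ⟨i, Finset.mem_range.2 hi, hxi, fun h => hx ?_⟩
        exact Set.mem_iUnion₂.2 ⟨i, hi, h⟩
      · left; exact hxA
    have h1 : μ Uᶜ ≤ ENNReal.ofReal (2 * κ') := by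
      calc μ Uᶜ ≤ μ (⋃ i < N, A i)ᶜ + μ (⋃ i ∈ Finset.range N, (A i \ B i)) :=
            (measure_mono hsub).trans (measure_union_le _ _)
        _ ≤ ENNReal.ofReal κ' + ∑ i ∈ Finset.range N, ENNReal.ofReal (κ' / (N + 1)) := by
            gcongr
            exact (measure_biUnion_finset_le _ _).trans (Finset.sum_le_sum fun i _ => hBκ i)
        _ ≤ ENNReal.ofReal κ' + ENNReal.ofReal κ' := by
            gcongr
            rw [← ENNReal.ofReal_sum_of_nonneg (fun i _ => by positivity)]
            apply ENNReal.ofReal_le_ofReal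
            rw [Finset.sum_const, Finset.card_range, nsmul_eq_mul, mul_div_assoc',
              div_le_iff₀ (by positivity)]
            nlinarith
        _ = ENNReal.ofReal (2 * κ') := by
            rw [← ENNReal.ofReal_add hκ'0.le hκ'0.le]; congr 1; ring
    exact ENNReal.toReal_le_of_le_ofReal (by positivity) h1
  let S : Set X := {x | (M : ℝ) < φ x}
  have hSm : MeasurableSet S := measurableSet_lt measurable_const ham
  let g : X → ℝ := fun x => 2 * S.indicator φ x + Uᶜ.indicator (fun _ => 2 * (M : ℝ)) x
  have hi1 : Integrable (fun x => 2 * S.indicator φ x) μ := (hai.indicator hSm).const_mul 2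
  have hi2 : Integrable (fun x => Uᶜ.indicator (fun _ => 2 * (M : ℝ)) x) μ :=
    (integrable_const _).indicator hUm.compl
  have hg1 : ∀ x, 0 ≤ S.indicator φ x := fun x => Set.indicator_nonneg (fun x _ => hφ0 x) x
  have hg2 : ∀ x, 0 ≤ Uᶜ.indicator (fun _ => 2 * (M : ℝ)) x := fun x =>
    Set.indicator_nonneg (fun x _ => by positivity) x
  have hg0 : ∀ x, 0 ≤ g x := fun x => by
    have := hg1 x; have := hg2 x; simp only [g]; linarith
  -- properties of g
  have hgφ : ∀ x, x ∉ U ∨ x ∈ S → φ x + M ≤ g x := by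
    intro x hx
    have h1 := hg1 x
    have h2 := hg2 x
    simp only [g]
    by_cases hxS : x ∈ S
    · rw [Set.indicator_of_mem hxS]
      have : (M : ℝ) < φ x := hxS
      linarith
    · have hxU : x ∈ Uᶜ := by tauto
      rw [Set.indicator_of_mem hxU]
      have : ¬ ((M : ℝ) < φ x) := hxS
      linarith
  have htri : ∀ x y, ρ' x y ≤ φ x + φ y := by
    intro x y
    have := hρ'.triangle x a y
    rw [hρ'.symm a y] at this
    exact this
  refine ⟨2 * M / c, m, g, by positivity,
    ((ham.indicator hSm).const_mul 2).add (measurable_const.indicator hUm.compl), hg0,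
    hi1.add hi2, ?_, ?_⟩
  · have : ∫ x, g x ∂μ = 2 * ∫ x, S.indicator φ x ∂μ + μ.real Uᶜ * (2 * M) := by
      simp only [g]
      rw [integral_add hi1 hi2, integral_const_mul, integral_indicator_const _ hUm.compl,
        smul_eq_mul]
    rw [this]
    have e : μ.real Uᶜ * (2 * M) ≤ κ / 2 := by
      calc μ.real Uᶜ * (2 * M) ≤ (2 * κ') * (2 * M) := by gcongr
        _ ≤ (2 * κ') * (2 * (M + 1)) := by gcongr; linarith
        _ = κ / 2 := by rw [hκ']; field_simp; norm_num
    have hM' : ∫ x, S.indicator φ x ∂μ < κ / 4 := hM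
    linarith
  · intro x y
    have hsum : 0 ≤ ∑ k ∈ Finset.Icc (-(m : ℤ)) m, ρ ((T ^ k) x) ((T ^ k) y) :=
      Finset.sum_nonneg fun k _ => hρ.nonneg _ _
    have hCs : 0 ≤ 2 * M / c * ∑ k ∈ Finset.Icc (-(m : ℤ)) m, ρ ((T ^ k) x) ((T ^ k) y) :=
      mul_nonneg (by positivity) hsum
    have hxy := htri x y
    have hgx := hg0 x
    have hgy := hg0 y
    by_cases hx : x ∉ U ∨ x ∈ S
    · have h1 := hgφ x hx
      by_cases hy : y ∉ U ∨ y ∈ S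
      · have h2 := hgφ y hy
        linarith
      · push Not at hy
        have : ¬ ((M : ℝ) < φ y) := hy.2
        linarith
    · push Not at hx
      have hxM : ¬ ((M : ℝ) < φ x) := hx.2
      by_cases hy : y ∉ U ∨ y ∈ S
      · have h2 := hgφ y hy
        linarith
      · push Not at hy
        have hyM : ¬ ((M : ℝ) < φ y) := hy.2
        obtain ⟨i, hi, hxi⟩ := Set.mem_iUnion₂.1 hx.1
        obtain ⟨j, hj, hyj⟩ := Set.mem_iUnion₂.1 hy.1
        by_cases hij : i = j
        · subst hij
          have := hAη i x (hBA i hxi) y (hBA i hyj)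
          linarith
        · have h3 := hB i hi j hj hij x hxi y hyj
          have h4 : 2 * (M : ℝ) ≤
              2 * M / c * ∑ k ∈ Finset.Icc (-(m : ℤ)) m, ρ ((T ^ k) x) ((T ^ k) y) := by
            calc 2 * (M : ℝ) = 2 * M / c * c := by field_simp
              _ ≤ _ := by gcongr
          linarith

lemma aux_int_comp (μ : Measure X) (S : X → X) (hS : MeasurePreserving S μ μ) (f : X → ℝ)
    (hf : Measurable f) : ∫ x, f (S x) ∂μ = ∫ x, f x ∂μ := by
  conv_rhs => rw [← hS.map_eq]
  rw [integral_map hS.measurable.aemeasurable hf.aestronglyMeasurable]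

/-- boundary indices -/
noncomputable def auxBdry (m n : ℕ) : Finset ℤ := Finset.Ico (-(m : ℤ)) 0 ∪ Finset.Ico (n : ℤ) (n + m)

lemma aux_sum_shift (r : ℤ → ℝ) (hr : ∀ i, 0 ≤ r i) (m n : ℕ) (k : ℤ)
    (hk : k ∈ Finset.Icc (-(m : ℤ)) m) :
    ∑ j ∈ Finset.range n, r (k + j) ≤ ∑ j ∈ Finset.range n, r j + ∑ i ∈ auxBdry m n, r i := by
  rw [Finset.mem_Icc] at hk
  have e1 : ∑ j ∈ Finset.range n, r (k + j) =
      ∑ i ∈ (Finset.range n).image (fun j : ℕ => k + (j : ℤ)), r i := by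
    rw [Finset.sum_image]
    intro a _ b _ h
    simpa using h
  have e2 : ∑ j ∈ Finset.range n, r j =
      ∑ i ∈ (Finset.range n).image (fun j : ℕ => (j : ℤ)), r i := by
    rw [Finset.sum_image]
    intro a _ b _ h
    simpa using h
  rw [e1, e2, ← Finset.sum_union]
  · apply Finset.sum_le_sum_of_subset_of_nonneg
    · intro i hi
      simp only [Finset.mem_image, Finset.mem_range, Finset.mem_union, auxBdry,
        Finset.mem_Ico] at hi ⊢
      obtain ⟨j, hj, rfl⟩ := hi
      by_cases h1 : 0 ≤ k + (j : ℤ) ∧ k + (j : ℤ) < n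
      · left
        exact ⟨(k + (j : ℤ)).toNat, by omega, by omega⟩
      · right; omega
    · intro i _ _; exact hr i
  · rw [Finset.disjoint_left]
    intro i hi hi'
    simp only [Finset.mem_image, Finset.mem_range, Finset.mem_union, auxBdry,
        Finset.mem_Ico] at hi hi'
    obtain ⟨j, hj, rfl⟩ := hi
    omega

lemma aux_card (m n : ℕ) : ((auxBdry m n).card : ℝ) ≤ 2 * m := by
  have : (auxBdry m n).card ≤ 2 * m := by
    refine (Finset.card_union_le _ _).trans ?_
    simp
    omega
  exact_mod_cast this

lemma aux_main [StandardBorelSpace X] (μ : Measure X) [IsProbabilityMeasure μ]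
    (T : Equiv.Perm X) (hmp : ∀ k : ℤ, MeasurePreserving (⇑(T ^ k)) μ μ)
    (ρ ρ' : X → X → ℝ)
    (hρ : IsSemimetric ρ) (hρmeas : Measurable fun p : X × X => ρ p.1 p.2)
    (hρint : MeasureTheory.Integrable (fun p : X × X => ρ p.1 p.2) (μ.prod μ))
    (hρadm : IsAdmissible μ ρ) (hρgen : IsGenerating μ T ρ)
    (hρ' : IsSemimetric ρ') (hρ'meas : Measurable fun p : X × X => ρ' p.1 p.2)
    (hρ'int : MeasureTheory.Integrable (fun p : X × X => ρ' p.1 p.2) (μ.prod μ))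
    (hρ'adm : IsAdmissible μ ρ') (ε : ℝ) (hε : 0 < ε) :
    ∃ δ : ℝ, 0 < δ ∧ ∀ᶠ n : ℕ in atTop, ∀ k, IsEntropyPartition μ (avgSemimetric T ρ n) δ k →
      IsEntropyPartition μ (avgSemimetric T ρ' n) ε k := by
  obtain ⟨b, hbm, hbi⟩ := aux_point μ ρ hρmeas hρint
  set φ : X → ℝ := fun x => ρ x b with hφ
  have hφ0 : ∀ x, 0 ≤ φ x := fun x => hρ.nonneg _ _
  set κ : ℝ := ε ^ 2 / 64 with hκ
  have hκ0 : 0 < κ := by positivity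
  obtain ⟨C, m, g, hC, hgm, hg0, hgi, hgκ, hkey⟩ := aux_key μ T hmp ρ ρ' hρ hρmeas hρadm hρgen
    hρ' hρ'meas hρ'int hρ'adm (ε / 8) κ (by linarith) hκ0
  set C' : ℝ := C * (2 * m + 1) with hC'
  have hC'0 : 0 ≤ C' := by positivity
  set δ : ℝ := min (ε / 4) (ε / 4 / (C' + 1)) with hδ
  have hδ0 : 0 < δ := lt_min (by linarith) (by positivity)
  have hδ1 : δ ≤ ε / 4 := min_le_left _ _
  have hδ2 : C' * δ ≤ ε / 4 := by
    calc C' * δ ≤ (C' + 1) * (ε / 4 / (C' + 1)) := by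
          apply mul_le_mul (by linarith) (min_le_right _ _) hδ0.le (by positivity)
      _ = ε / 4 := by field_simp
  refine ⟨δ, hδ0, ?_⟩
  have hφI : 0 ≤ ∫ x, φ x ∂μ := integral_nonneg hφ0
  obtain ⟨N₀, hN₀⟩ := exists_nat_ge (C' * (2 * m) * (∫ x, φ x ∂μ) / κ)
  filter_upwards [eventually_ge_atTop (N₀ + 1)] with n hn k hP
  have hn0 : (0 : ℝ) < n := by
    have : 0 < n := by omega
    exact_mod_cast this
  have hnN : (N₀ : ℝ) ≤ n := by
    have : N₀ ≤ n := by omega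
    exact_mod_cast this
  -- the error function
  let H : X → ℝ := fun x => (∑ j ∈ Finset.range n, g ((T ^ (j : ℤ)) x) +
    C' * ∑ i ∈ auxBdry m n, φ ((T ^ i) x)) / n
  have hHm : Measurable H := by
    refine Measurable.div_const (Measurable.add ?_ (Measurable.const_mul ?_ _)) _
    · exact Finset.measurable_fun_sum _ fun j _ => hgm.comp (hmp j).measurable
    · exact Finset.measurable_fun_sum _ fun j _ => hbm.comp (hmp j).measurable
  have hH0 : ∀ x, 0 ≤ H x := fun x => by
    have h1 : 0 ≤ ∑ j ∈ Finset.range n, g ((T ^ (j : ℤ)) x) :=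
      Finset.sum_nonneg fun j _ => hg0 _
    have h2 : 0 ≤ ∑ i ∈ auxBdry m n, φ ((T ^ i) x) := Finset.sum_nonneg fun j _ => hφ0 _
    simp only [H]; positivity
  have hg_i : ∀ j ∈ Finset.range n, Integrable (fun x => g ((T ^ (j : ℤ)) x)) μ := fun j _ =>
    (hmp j).integrable_comp_of_integrable hgi
  have hφ_i : ∀ i ∈ auxBdry m n, Integrable (fun x => φ ((T ^ i) x)) μ := fun j _ =>
    (hmp j).integrable_comp_of_integrable hbi
  have hHi : Integrable H μ :=
    ((integrable_finset_sum _ hg_i).add ((integrable_finset_sum _ hφ_i).const_mul C')).div_const _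
  have hHint : ∫ x, H x ∂μ ≤ 2 * κ := by
    have e : ∫ x, H x ∂μ = (n * ∫ x, g x ∂μ + C' * ((auxBdry m n).card * ∫ x, φ x ∂μ)) / n := by
      simp only [H]
      rw [integral_div, integral_add (integrable_finset_sum _ hg_i)
        ((integrable_finset_sum _ hφ_i).const_mul C'), integral_const_mul,
        integral_finset_sum _ hg_i, integral_finset_sum _ hφ_i]
      congr 2
      · rw [Finset.sum_congr rfl fun (j : ℕ) _ => aux_int_comp μ _ (hmp (j : ℤ)) g hgm]
        simp
      · rw [Finset.sum_congr rfl fun j _ => aux_int_comp μ _ (hmp j) φ hbm]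
        simp
    rw [e, div_le_iff₀ hn0]
    have h1 : C' * ((auxBdry m n).card * ∫ x, φ x ∂μ) ≤ C' * (2 * m * ∫ x, φ x ∂μ) := by
      gcongr
      exact aux_card m n
    have h2 : C' * (2 * m * ∫ x, φ x ∂μ) ≤ n * κ := by
      rw [div_le_iff₀ hκ0] at hN₀
      nlinarith
    have h3 : n * ∫ x, g x ∂μ ≤ n * κ := by gcongr
    linarith
  let bad : Set X := {x | ε / 8 ≤ H x}
  have hbadm : MeasurableSet bad := measurableSet_le measurable_const hHm
  have hbad : μ bad ≤ ENNReal.ofReal (ε / 4) := by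
    have h1 := mul_meas_ge_le_integral_of_nonneg (Eventually.of_forall hH0) hHi (ε / 8)
    have h2 : μ.real bad ≤ ε / 4 := by
      have h3 : ε / 8 * μ.real bad ≤ 2 * κ := h1.trans hHint
      rw [hκ] at h3
      nlinarith
    rw [← ofReal_measureReal]
    exact ENNReal.ofReal_le_ofReal h2
  have havg : ∀ x y, avgSemimetric T ρ' n x y ≤
      ε / 8 + C' * avgSemimetric T ρ n x y + H x + H y := by
    intro x y
    simp only [avgSemimetric, H]
    have hb : ∀ i : ℤ, ρ ((T ^ i) x) ((T ^ i) y) ≤ φ ((T ^ i) x) + φ ((T ^ i) y) := by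
      intro i
      have := hρ.triangle ((T ^ i) x) b ((T ^ i) y)
      rw [hρ.symm b] at this
      exact this
    set R := ∑ j ∈ Finset.range n, ρ ((T ^ j) x) ((T ^ j) y) with hR
    set E := ∑ i ∈ auxBdry m n, ρ ((T ^ i) x) ((T ^ i) y) with hE
    have hEb : E ≤ ∑ i ∈ auxBdry m n, φ ((T ^ i) x) + ∑ i ∈ auxBdry m n, φ ((T ^ i) y) := by
      rw [← Finset.sum_add_distrib]
      exact Finset.sum_le_sum fun i _ => hb i
    have hsum : ∑ j ∈ Finset.range n, ρ' ((T ^ j) x) ((T ^ j) y) ≤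
        n * (ε / 8) + C' * (R + E) + ∑ j ∈ Finset.range n, g ((T ^ (j : ℤ)) x) +
          ∑ j ∈ Finset.range n, g ((T ^ (j : ℤ)) y) := by
      have h1 : ∑ j ∈ Finset.range n, ρ' ((T ^ j) x) ((T ^ j) y) ≤
          ∑ j ∈ Finset.range n, (ε / 8 + C * ∑ k ∈ Finset.Icc (-(m : ℤ)) m,
            ρ ((T ^ (k + j)) x) ((T ^ (k + j)) y) + g ((T ^ (j : ℤ)) x) +
              g ((T ^ (j : ℤ)) y)) := by
        apply Finset.sum_le_sum
        intro j _
        have := hkey ((T ^ (j : ℤ)) x) ((T ^ (j : ℤ)) y)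
        simp only [← Equiv.Perm.mul_apply, ← zpow_add] at this
        simpa only [zpow_natCast] using this
      have h2 : ∑ j ∈ Finset.range n, ∑ k ∈ Finset.Icc (-(m : ℤ)) m,
            ρ ((T ^ (k + j)) x) ((T ^ (k + j)) y) ≤ (2 * m + 1) * (R + E) := by
        rw [Finset.sum_comm]
        calc _ ≤ ∑ k ∈ Finset.Icc (-(m : ℤ)) m, (R + E) := by
              apply Finset.sum_le_sum
              intro k hk
              have := aux_sum_shift (fun i : ℤ => ρ ((T ^ i) x) ((T ^ i) y))
                (fun i => hρ.nonneg _ _) m n k hk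
              simpa only [zpow_natCast] using this
          _ = (2 * m + 1) * (R + E) := by
              rw [Finset.sum_const, Int.card_Icc, nsmul_eq_mul]
              congr 1
              have : ((m : ℤ) + 1 - -(m : ℤ)).toNat = 2 * m + 1 := by omega
              rw [this]; push_cast; ring
      have h3 := mul_le_mul_of_nonneg_left h2 hC
      rw [Finset.sum_add_distrib, Finset.sum_add_distrib, Finset.sum_add_distrib,
        ← Finset.mul_sum, Finset.sum_const, Finset.card_range, nsmul_eq_mul] at h1
      have h4 : C * ((2 * m + 1) * (R + E)) = C' * (R + E) := by rw [hC']; ring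
      linarith
    have h5 := mul_le_mul_of_nonneg_left hEb hC'0
    rw [div_le_iff₀ hn0]
    have h6 : (ε / 8 + C' * (R / n) +
        (∑ j ∈ Finset.range n, g ((T ^ (j : ℤ)) x) + C' * ∑ i ∈ auxBdry m n, φ ((T ^ i) x)) / n +
        (∑ j ∈ Finset.range n, g ((T ^ (j : ℤ)) y) + C' * ∑ i ∈ auxBdry m n, φ ((T ^ i) y)) / n)
        * n = n * (ε / 8) + C' * R +
        (∑ j ∈ Finset.range n, g ((T ^ (j : ℤ)) x) + C' * ∑ i ∈ auxBdry m n, φ ((T ^ i) x)) +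
        (∑ j ∈ Finset.range n, g ((T ^ (j : ℤ)) y) + C' * ∑ i ∈ auxBdry m n, φ ((T ^ i) y)) := by
      field_simp
    rw [h6]
    linarith
  -- build the new partition
  obtain ⟨P, hPm, hPd, hPu, hP0, hPδ⟩ := hP
  refine ⟨fun j => if j = 0 then P 0 ∪ bad else P j \ bad, ?_, ?_, ?_, ?_, ?_⟩
  · intro j
    dsimp only
    split_ifs
    · exact (hPm 0).union hbadm
    · exact (hPm j).diff hbadm
  · intro i j hij
    have hd : Disjoint (P i) (P j) := hPd hij
    rw [Set.disjoint_left] at hd ⊢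
    intro x hx hx'
    dsimp only at hx hx'
    split_ifs at hx hx' with h1 h2 h2
    · exact hij (h1.trans h2.symm)
    · subst h1
      rcases hx with hx | hx
      · exact hd hx hx'.1
      · exact hx'.2 hx
    · subst h2
      rcases hx' with hx' | hx'
      · exact hd hx.1 hx'
      · exact hx.2 hx'
    · exact hd hx.1 hx'.1
  · rw [Set.eq_univ_iff_forall] at hPu ⊢
    intro x
    obtain ⟨j, hj⟩ := Set.mem_iUnion.1 (hPu x)
    by_cases hx : x ∈ bad
    · exact Set.mem_iUnion.2 ⟨0, by simp [hx]⟩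
    · refine Set.mem_iUnion.2 ⟨j, ?_⟩
      split_ifs with h
      · subst h; exact Or.inl hj
      · exact ⟨hj, hx⟩
  · simp only [if_true]
    calc μ (P 0 ∪ bad) ≤ μ (P 0) + μ bad := measure_union_le _ _
      _ < ENNReal.ofReal δ + ENNReal.ofReal (ε / 4) :=
          ENNReal.add_lt_add_of_lt_of_le (measure_ne_top _ _) hP0 hbad
      _ = ENNReal.ofReal (δ + ε / 4) := (ENNReal.ofReal_add hδ0.le (by linarith)).symm
      _ ≤ ENNReal.ofReal ε := ENNReal.ofReal_le_ofReal (by linarith)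
  · intro j hj x hx y hy
    simp only [if_neg hj] at hx hy
    have h1 := havg x y
    have h2 := mul_le_mul_of_nonneg_left (hPδ j hj x hx.1 y hy.1).le hC'0
    have h3 : ¬ (ε / 8 ≤ H x) := hx.2
    have h4 : ¬ (ε / 8 ≤ H y) := hy.2
    linarith

lemma aux_entropy_le (μ : Measure X) (ρ ρ' : X → X → ℝ) (δ ε : ℝ)
    (h : ∀ k, IsEntropyPartition μ ρ δ k → IsEntropyPartition μ ρ' ε k) :
    epsEntropy μ ρ' ε ≤ epsEntropy μ ρ δ := by
  classical
  unfold epsEntropy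
  by_cases h1 : ∃ k, IsEntropyPartition μ ρ δ k
  · have h2 : ∃ k, IsEntropyPartition μ ρ' ε k := h1.imp h
    rw [dif_pos h1, dif_pos h2]
    apply ENNReal.ofReal_le_ofReal
    have hle : Nat.find h2 ≤ Nat.find h1 := Nat.find_min' h2 (h _ (Nat.find_spec h1))
    rcases Nat.eq_zero_or_pos (Nat.find h2) with h0 | h0
    · rw [h0]
      simp only [Nat.cast_zero, Real.logb_zero]
      rcases Nat.eq_zero_or_pos (Nat.find h1) with h0' | h0'
      · rw [h0']; simp
      · exact Real.logb_nonneg (by norm_num) (by exact_mod_cast h0')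
    · exact Real.logb_le_logb_of_le (by norm_num) (by exact_mod_cast h0) (by exact_mod_cast hle)
  · rw [dif_neg h1]
    exact le_top

lemma aux_partition_mono (μ : Measure X) (ρ : X → X → ℝ) (δ ε : ℝ) (hle : δ ≤ ε) (k : ℕ)
    (h : IsEntropyPartition μ ρ δ k) : IsEntropyPartition μ ρ ε k := by
  obtain ⟨P, h1, h2, h3, h4, h5⟩ := h
  exact ⟨P, h1, h2, h3, h4.trans_le (ENNReal.ofReal_le_ofReal hle),
    fun j hj x hx y hy => (h5 j hj x hx y hy).trans_le hle⟩

lemma aux_scaling (μ : Measure X) (T : Equiv.Perm X) (ρ ρ' : X → X → ℝ)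
    (h₁ : ∀ ε : ℝ, 0 < ε → ∃ δ : ℝ, 0 < δ ∧ ∀ᶠ n : ℕ in atTop, ∀ k,
      IsEntropyPartition μ (avgSemimetric T ρ n) δ k →
      IsEntropyPartition μ (avgSemimetric T ρ' n) ε k)
    (h₂ : ∀ ε : ℝ, 0 < ε → ∃ δ : ℝ, 0 < δ ∧ ∀ᶠ n : ℕ in atTop, ∀ k,
      IsEntropyPartition μ (avgSemimetric T ρ' n) δ k →
      IsEntropyPartition μ (avgSemimetric T ρ n) ε k)
    (h : ℕ → ℝ) (hh : IsScalingSeq μ T ρ h) : IsScalingSeq μ T ρ' h := by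
  obtain ⟨hpos, hsup, ε₀, hε₀, hinf⟩ := hh
  refine ⟨hpos, fun ε hε => ?_, ?_⟩
  · obtain ⟨δ, hδ, hev⟩ := h₁ ε hε
    refine lt_of_le_of_lt (Filter.limsup_le_limsup ?_) (hsup δ hδ)
    filter_upwards [hev] with n hn
    exact ENNReal.div_le_div_right (aux_entropy_le μ _ _ _ _ hn) _
  · obtain ⟨δ, hδ, hev⟩ := h₂ (ε₀ / 2) (by linarith)
    refine ⟨δ, hδ, fun ε hε hεδ => ?_⟩
    refine lt_of_lt_of_le (hinf (ε₀ / 2) (by linarith) (by linarith))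
      (Filter.liminf_le_liminf ?_)
    filter_upwards [hev] with n hn
    exact ENNReal.div_le_div_right (aux_entropy_le μ _ _ _ _ fun k hk =>
      hn k (aux_partition_mono μ _ _ _ hεδ.le k hk)) _

/-- Two summable admissible generating semimetrics for an ergodic automorphism of
a standard probability space have the same class of scaling sequences:
`ℋ(X,μ,T,ρ) = ℋ(X,μ,T,ρ̃)`. -/
theorem scalingSeq_class_eq_of_generating
    {X : Type*} [MeasurableSpace X] [StandardBorelSpace X]
    (μ : Measure X) [IsProbabilityMeasure μ]
    (T : Equiv.Perm X) (hT : Measurable (⇑T)) (hTsymm : Measurable (⇑T.symm))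
    (hTerg : Ergodic (⇑T) μ)
    (ρ ρ' : X → X → ℝ)
    (hρ : IsSemimetric ρ) (hρmeas : Measurable fun p : X × X => ρ p.1 p.2)
    (hρint : MeasureTheory.Integrable (fun p : X × X => ρ p.1 p.2) (μ.prod μ))
    (hρadm : IsAdmissible μ ρ) (hρgen : IsGenerating μ T ρ)
    (hρ' : IsSemimetric ρ') (hρ'meas : Measurable fun p : X × X => ρ' p.1 p.2)
    (hρ'int : MeasureTheory.Integrable (fun p : X × X => ρ' p.1 p.2) (μ.prod μ))
    (hρ'adm : IsAdmissible μ ρ') (hρ'gen : IsGenerating μ T ρ') :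
    {h : ℕ → ℝ | IsScalingSeq μ T ρ h} = {h : ℕ → ℝ | IsScalingSeq μ T ρ' h} := by
  have hmp := aux_mp μ T hTerg.toMeasurePreserving hTsymm
  have h₁ := aux_main μ T hmp ρ ρ' hρ hρmeas hρint hρadm hρgen hρ' hρ'meas hρ'int hρ'adm
  have h₂ := aux_main μ T hmp ρ' ρ hρ' hρ'meas hρ'int hρ'adm hρ'gen hρ hρmeas hρint hρadm
  ext h
  exact ⟨aux_scaling μ T ρ ρ' h₁ h₂ h, aux_scaling μ T ρ' ρ h₂ h₁ h⟩
end

section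
/- Let T be an ergodic automorphism of a standard probability space (X,μ). If the Kolmogorov (measure-theoretic) entropy h_μ(T) is finite and positive, then the sequence h_n = n is a scaling entropy sequence of the system (X,μ,T). -/
open MeasureTheory Filter Set
open scoped ENNReal

variable {X : Type*} [MeasurableSpace X]

section ScalingHelpers

/-- Real-valued Shannon entropy of a finite distribution. -/
noncomputable def distEnt {A : Type*} [Fintype A] (p : A → ℝ) : ℝ :=
  ∑ a, -(p a * Real.logb 2 (p a))

lemma gibbs {A : Type*} [Fintype A] (p q : A → ℝ) (hp : ∀ a, 0 ≤ p a) (hq : ∀ a, 0 ≤ q a)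
    (hpq : ∀ a, 0 < p a → 0 < q a) (h1 : ∑ a, p a = 1) (h2 : ∑ a, q a ≤ 1) :
    distEnt p ≤ ∑ a, -(p a * Real.logb 2 (q a)) := by
  have hl : 0 < Real.log 2 := Real.log_pos (by norm_num)
  have key : ∀ a, -(p a * Real.logb 2 (p a)) ≤
      -(p a * Real.logb 2 (q a)) + (q a - p a) / Real.log 2 := by
    intro a
    rcases (hp a).eq_or_lt with h | h
    · rw [← h]; simp; exact div_nonneg (hq a) hl.le
    · have hqa := hpq a h
      have h3 := Real.log_le_sub_one_of_pos (div_pos hqa h)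
      rw [Real.log_div hqa.ne' h.ne'] at h3
      have h4 : p a * (Real.log (q a) - Real.log (p a)) ≤ q a - p a := by
        have := mul_le_mul_of_nonneg_left h3 h.le
        calc _ ≤ _ := this
          _ = _ := by field_simp
      have h5 := div_le_div_of_nonneg_right h4 hl.le
      simp only [Real.logb]
      have h6 : p a * (Real.log (q a) - Real.log (p a)) / Real.log 2 =
        p a * (Real.log (q a) / Real.log 2) - p a * (Real.log (p a) / Real.log 2) := by ring
      linarith
  calc distEnt p ≤ ∑ a, (-(p a * Real.logb 2 (q a)) + (q a - p a) / Real.log 2) :=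
        Finset.sum_le_sum fun a _ => key a
    _ = ∑ a, -(p a * Real.logb 2 (q a)) + (∑ a, q a - ∑ a, p a) / Real.log 2 := by
        rw [Finset.sum_add_distrib, ← Finset.sum_div, Finset.sum_sub_distrib]
    _ ≤ _ := by
        have : (∑ a, q a - ∑ a, p a) / Real.log 2 ≤ 0 :=
          div_nonpos_of_nonpos_of_nonneg (by linarith) hl.le
        linarith

lemma distEnt_le_of_set {A : Type*} [Fintype A] [DecidableEq A] (p : A → ℝ)
    (hp : ∀ a, 0 ≤ p a) (h1 : ∑ a, p a = 1) (G : Finset A) (hG : G.Nonempty) (ε : ℝ)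
    (hε : ∑ a ∈ Gᶜ, p a ≤ ε) :
    distEnt p ≤ 1 + Real.logb 2 G.card + ε * Real.logb 2 (Fintype.card A) := by
  have hGc : (0 : ℝ) < G.card := by exact_mod_cast hG.card_pos
  have hGA : (G.card : ℝ) ≤ Fintype.card A := by exact_mod_cast Finset.card_le_univ G
  have hA : (0 : ℝ) < Fintype.card A := hGc.trans_le hGA
  have hLA : 0 ≤ Real.logb 2 (Fintype.card A) :=
    Real.logb_nonneg (by norm_num) (by
      have : 1 ≤ G.card := hG.card_pos
      have : (1 : ℝ) ≤ G.card := by exact_mod_cast this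
      linarith)
  have hLG : 0 ≤ Real.logb 2 G.card :=
    Real.logb_nonneg (by norm_num) (by exact_mod_cast hG.card_pos)
  have hs := Finset.sum_add_sum_compl G p
  have hnn : 0 ≤ ∑ a ∈ Gᶜ, p a := Finset.sum_nonneg fun a _ => hp a
  let q : A → ℝ := fun a => if a ∈ G then (2 * (G.card : ℝ))⁻¹ else (2 * (Fintype.card A : ℝ))⁻¹
  have hqG : ∀ a ∈ G, q a = (2 * (G.card : ℝ))⁻¹ := fun a h => by simp [q, h]
  have hqG' : ∀ a ∈ Gᶜ, q a = (2 * (Fintype.card A : ℝ))⁻¹ := fun a h => by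
    simp only [Finset.mem_compl] at h; simp [q, h]
  have hq : ∀ a, 0 < q a := by
    intro a; simp only [q]; split_ifs <;> positivity
  have hqs : ∑ a, q a ≤ 1 := by
    rw [← Finset.sum_add_sum_compl G, Finset.sum_congr rfl hqG, Finset.sum_congr rfl hqG']
    simp only [Finset.sum_const, nsmul_eq_mul]
    have e1 : (G.card : ℝ) * (2 * (G.card : ℝ))⁻¹ = 1 / 2 := by field_simp
    have e2 : ((Gᶜ).card : ℝ) * (2 * (Fintype.card A : ℝ))⁻¹ ≤ 1 / 2 := by
      have : ((Gᶜ).card : ℝ) ≤ Fintype.card A := by exact_mod_cast Finset.card_le_univ Gᶜ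
      calc _ ≤ (Fintype.card A : ℝ) * (2 * (Fintype.card A : ℝ))⁻¹ := by gcongr
        _ = _ := by field_simp
    linarith
  refine (gibbs p q hp (fun a => (hq a).le) (fun a _ => hq a) h1 hqs).trans ?_
  have l1 : Real.logb 2 ((2 * (G.card : ℝ))⁻¹) = -(1 + Real.logb 2 G.card) := by
    rw [Real.logb_inv, Real.logb_mul (by norm_num) hGc.ne', Real.logb_self_eq_one (by norm_num)]
  have l2 : Real.logb 2 ((2 * (Fintype.card A : ℝ))⁻¹) =
      -(1 + Real.logb 2 (Fintype.card A)) := by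
    rw [Real.logb_inv, Real.logb_mul (by norm_num) hA.ne', Real.logb_self_eq_one (by norm_num)]
  rw [← Finset.sum_add_sum_compl G]
  have e1 : ∑ a ∈ G, -(p a * Real.logb 2 (q a)) = (∑ a ∈ G, p a) * (1 + Real.logb 2 G.card) := by
    rw [Finset.sum_mul]
    refine Finset.sum_congr rfl fun a ha => ?_
    rw [hqG a ha, l1]; ring
  have e2 : ∑ a ∈ Gᶜ, -(p a * Real.logb 2 (q a)) =
      (∑ a ∈ Gᶜ, p a) * (1 + Real.logb 2 (Fintype.card A)) := by
    rw [Finset.sum_mul]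
    refine Finset.sum_congr rfl fun a ha => ?_
    rw [hqG' a ha, l2]; ring
  rw [e1, e2]
  have i1 := mul_le_mul_of_nonneg_right hε hLA
  have i2 : (∑ a ∈ G, p a) * Real.logb 2 G.card ≤ 1 * Real.logb 2 G.card :=
    mul_le_mul_of_nonneg_right (by linarith) hLG
  nlinarith

/-- Law of a map with finite range. -/
noncomputable def lawOf {Y A : Type*} [MeasurableSpace Y] (μ : Measure Y) (F : Y → A) : A → ℝ :=
  fun a => (μ (F ⁻¹' {a})).toReal

lemma lawOf_nonneg {Y A : Type*} [MeasurableSpace Y] (μ : Measure Y) (F : Y → A) (a : A) :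
    0 ≤ lawOf μ F a := ENNReal.toReal_nonneg

lemma sum_lawOf_finset {Y A : Type*} [MeasurableSpace Y] (μ : Measure Y)
    [IsProbabilityMeasure μ] (F : Y → A) (hF : ∀ a, MeasurableSet (F ⁻¹' {a})) (s : Finset A) :
    ∑ a ∈ s, lawOf μ F a = (μ (F ⁻¹' s)).toReal := by
  rw [← sum_measure_preimage_singleton s (fun a _ => hF a),
    ENNReal.toReal_sum (fun a _ => measure_ne_top _ _)]
  rfl

lemma sum_lawOf {Y A : Type*} [MeasurableSpace Y] [Fintype A] (μ : Measure Y)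
    [IsProbabilityMeasure μ] (F : Y → A) (hF : ∀ a, MeasurableSet (F ⁻¹' {a})) :
    ∑ a, lawOf μ F a = 1 := by
  rw [sum_lawOf_finset μ F hF]; simp

lemma distEnt_prod_le {Y A B : Type*} [MeasurableSpace Y] [Fintype A] [Fintype B]
    (μ : Measure Y) [IsProbabilityMeasure μ] (F : Y → A) (G : Y → B)
    (hF : ∀ a, MeasurableSet (F ⁻¹' {a})) (hG : ∀ a, MeasurableSet (G ⁻¹' {a})) :
    distEnt (lawOf μ (fun x => (F x, G x))) ≤ distEnt (lawOf μ F) + distEnt (lawOf μ G) := by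
  have hFG : ∀ c, MeasurableSet ((fun x => (F x, G x)) ⁻¹' {c}) := by
    rintro ⟨a, b⟩
    convert (hF a).inter (hG b) using 1
    ext x; simp
  have hm1 : ∀ c : A × B, lawOf μ (fun x => (F x, G x)) c ≤ lawOf μ F c.1 := fun c =>
    ENNReal.toReal_mono (measure_ne_top _ _) (measure_mono (by rintro x rfl; simp))
  have hm2 : ∀ c : A × B, lawOf μ (fun x => (F x, G x)) c ≤ lawOf μ G c.2 := fun c =>
    ENNReal.toReal_mono (measure_ne_top _ _) (measure_mono (by rintro x rfl; simp))
  refine (gibbs _ (fun c : A × B => lawOf μ F c.1 * lawOf μ G c.2) (lawOf_nonneg μ _)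
    (fun c => mul_nonneg (lawOf_nonneg _ _ _) (lawOf_nonneg _ _ _))
    (fun c hc => mul_pos (hc.trans_le (hm1 c)) (hc.trans_le (hm2 c)))
    (sum_lawOf μ _ hFG) ?_).trans ?_
  · rw [Fintype.sum_prod_type]
    simp only [← Finset.mul_sum, sum_lawOf μ G hG, mul_one, sum_lawOf μ F hF, le_refl]
  · have hterm : ∀ c : A × B, -(lawOf μ (fun x => (F x, G x)) c *
        Real.logb 2 (lawOf μ F c.1 * lawOf μ G c.2)) =
        -(lawOf μ (fun x => (F x, G x)) c * Real.logb 2 (lawOf μ F c.1)) +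
        -(lawOf μ (fun x => (F x, G x)) c * Real.logb 2 (lawOf μ G c.2)) := by
      intro c
      rcases (lawOf_nonneg μ (fun x => (F x, G x)) c).eq_or_lt with h | h
      · rw [← h]; simp
      · rw [Real.logb_mul (h.trans_le (hm1 c)).ne' (h.trans_le (hm2 c)).ne']; ring
    rw [Finset.sum_congr rfl (fun c _ => hterm c), Finset.sum_add_distrib]
    have marg1 : ∀ a, ∑ b, lawOf μ (fun x => (F x, G x)) (a, b) = lawOf μ F a := by
      intro a
      classical
      have := sum_lawOf_finset μ _ hFG (({a} : Finset A) ×ˢ (Finset.univ : Finset B))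
      rw [Finset.sum_product] at this
      simp only [Finset.sum_singleton] at this
      rw [this]; unfold lawOf; congr 2; ext x; simp [eq_comm]
    have marg2 : ∀ b, ∑ a, lawOf μ (fun x => (F x, G x)) (a, b) = lawOf μ G b := by
      intro b
      classical
      have := sum_lawOf_finset μ _ hFG ((Finset.univ : Finset A) ×ˢ ({b} : Finset B))
      rw [Finset.sum_product] at this
      simp only [Finset.sum_singleton] at this
      rw [this]; unfold lawOf; congr 2; ext x; simp [eq_comm]
    refine le_of_eq ?_
    congr 1
    · rw [Fintype.sum_prod_type]
      refine Finset.sum_congr rfl fun a _ => ?_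
      simp only [Finset.sum_neg_distrib, ← Finset.sum_mul, marg1]
    · rw [Fintype.sum_prod_type_right]
      refine Finset.sum_congr rfl fun b _ => ?_
      simp only [Finset.sum_neg_distrib, ← Finset.sum_mul, marg2]

lemma distEnt_equiv {Y A B : Type*} [MeasurableSpace Y] [Fintype A] [Fintype B]
    (μ : Measure Y) (F : Y → A) (e : A ≃ B) :
    distEnt (lawOf μ (fun x => e (F x))) = distEnt (lawOf μ F) := by
  unfold distEnt
  rw [← e.sum_comp]
  refine Finset.sum_congr rfl fun a _ => ?_
  have : lawOf μ (fun x => e (F x)) (e a) = lawOf μ F a := by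
    unfold lawOf; congr 2; ext x; simp
  rw [this]

lemma lawOf_comp {Y A : Type*} [MeasurableSpace Y] (μ : Measure Y) (F : Y → A) (S : Y → Y)
    (hS : MeasurePreserving S μ μ) (hF : ∀ a, MeasurableSet (F ⁻¹' {a})) :
    lawOf μ (fun x => F (S x)) = lawOf μ F := by
  funext a
  unfold lawOf
  rw [← hS.measure_preimage (hF a).nullMeasurableSet]; rfl

lemma partitionEntropy_eq {Y A : Type*} [MeasurableSpace Y] [Fintype A] [Countable A]
    (μ : Measure Y) [IsProbabilityMeasure μ] (F : Y → A) :
    partitionEntropy μ F = ENNReal.ofReal (distEnt (lawOf μ F)) := by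
  unfold partitionEntropy distEnt
  rw [tsum_fintype, ENNReal.ofReal_sum_of_nonneg]
  · rfl
  · intro a _
    have : Real.logb 2 (lawOf μ F a) ≤ 0 :=
      Real.logb_nonpos (by norm_num) (lawOf_nonneg μ F a)
        (ENNReal.toReal_le_of_le_ofReal zero_le_one (by simpa using prob_le_one))
    have := mul_nonneg (lawOf_nonneg μ F a) (neg_nonneg.2 this)
    linarith

lemma distEnt_nonneg {Y A : Type*} [MeasurableSpace Y] [Fintype A]
    (μ : Measure Y) [IsProbabilityMeasure μ] (F : Y → A) : 0 ≤ distEnt (lawOf μ F) := by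
  refine Finset.sum_nonneg fun a _ => ?_
  have : Real.logb 2 (lawOf μ F a) ≤ 0 :=
    Real.logb_nonpos (by norm_num) (lawOf_nonneg μ F a)
      (ENNReal.toReal_le_of_le_ofReal zero_le_one (by simpa using prob_le_one))
  have := mul_nonneg (lawOf_nonneg μ F a) (neg_nonneg.2 this)
  linarith

/-- Names along the inverse orbit. -/
def nameOf {Y : Type*} {m : ℕ} (T : Equiv.Perm Y) (ξ : Y → Fin m) (n : ℕ) (x : Y) : Fin n → Fin m :=
  fun i => ξ ((T ^ (-(i : ℤ))) x)

lemma measurable_zpow_perm {Y : Type*} [MeasurableSpace Y] (T : Equiv.Perm Y)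
    (hT : Measurable T) (hT' : Measurable T.symm) (k : ℤ) : Measurable (⇑(T ^ k)) := by
  have h : ∀ (S : Equiv.Perm Y), Measurable S → ∀ j : ℕ, Measurable (⇑(S ^ j)) := by
    intro S hS j
    rw [Equiv.Perm.coe_pow]; exact hS.iterate j
  cases k with
  | ofNat j => exact_mod_cast h T hT j
  | negSucc j => rw [zpow_negSucc, ← inv_pow]; exact h T⁻¹ hT' (j + 1)

lemma mp_zpow_perm {Y : Type*} [MeasurableSpace Y] (μ : Measure Y) (T : Equiv.Perm Y)
    (hT : MeasurePreserving T μ μ) (hT' : Measurable T.symm) (k : ℤ) :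
    MeasurePreserving (⇑(T ^ k)) μ μ := by
  have h : ∀ (S : Equiv.Perm Y), MeasurePreserving S μ μ → ∀ j : ℕ,
      MeasurePreserving (⇑(S ^ j)) μ μ := by
    intro S hS j
    rw [Equiv.Perm.coe_pow]; exact hS.iterate j
  have hs : MeasurePreserving (⇑T⁻¹) μ μ :=
    MeasurePreserving.symm (⟨T, hT.measurable, hT'⟩ : Y ≃ᵐ Y) hT
  cases k with
  | ofNat j => exact_mod_cast h T hT j
  | negSucc j => rw [zpow_negSucc, ← inv_pow]; exact h T⁻¹ hs (j + 1)

lemma measurable_nameOf {Y : Type*} [MeasurableSpace Y] {m : ℕ} (T : Equiv.Perm Y)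
    (hT : Measurable T) (hT' : Measurable T.symm) (ξ : Y → Fin m) (hξ : Measurable ξ) (n : ℕ) :
    Measurable (nameOf T ξ n) :=
  measurable_pi_lambda _ fun i => hξ.comp (measurable_zpow_perm T hT hT' _)

lemma subadd_ent {Y : Type*} [MeasurableSpace Y] {m : ℕ} (μ : Measure Y) [IsProbabilityMeasure μ]
    (T : Equiv.Perm Y) (hT : MeasurePreserving T μ μ) (hT' : Measurable T.symm) (ξ : Y → Fin m)
    (hξ : Measurable ξ) : Subadditive (fun n => distEnt (lawOf μ (nameOf T ξ n))) := by
  intro a b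
  have hm := measurable_nameOf T hT.measurable hT' ξ hξ
  have e : nameOf T ξ (a + b) = fun x => Fin.appendEquiv a b
      (nameOf T ξ a x, nameOf T ξ b ((T ^ (-(a : ℤ))) x)) := by
    funext x i
    refine Fin.addCases (fun i => ?_) (fun i => ?_) i
    · simp [nameOf, Fin.appendEquiv]
    · simp only [nameOf, Fin.appendEquiv, Equiv.coe_fn_mk, Fin.append_right, Fin.val_natAdd]
      rw [← Equiv.Perm.mul_apply, ← zpow_add]
      congr 3; push_cast; ring
  have mp := mp_zpow_perm μ T hT hT' (-(a : ℤ))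
  simp only
  rw [e, distEnt_equiv μ (fun x => (nameOf T ξ a x, nameOf T ξ b ((T ^ (-(a : ℤ))) x)))]
  refine (distEnt_prod_le μ (nameOf T ξ a) (fun x => nameOf T ξ b ((T ^ (-(a : ℤ))) x))
    (fun c => hm a (measurableSet_singleton c))
    (fun c => ((hm b).comp mp.measurable) (measurableSet_singleton c))).trans ?_
  rw [lawOf_comp μ (nameOf T ξ b) _ mp (fun c => hm b (measurableSet_singleton c))]

lemma exists_ent_lower {Y : Type*} [MeasurableSpace Y] {m : ℕ} (μ : Measure Y)
    [IsProbabilityMeasure μ]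
    (T : Equiv.Perm Y) (hT : MeasurePreserving T μ μ) (hT' : Measurable T.symm) (ξ : Y → Fin m)
    (hξ : Measurable ξ)
    (hpos : 0 < Filter.limsup (fun n : ℕ =>
      partitionEntropy μ (fun x => fun i : Fin n => ξ ((T ^ (-(i : ℤ))) x)) / (n : ℝ≥0∞))
      Filter.atTop) :
    ∃ c : ℝ, 0 < c ∧ ∀ n : ℕ, 1 ≤ n → c * n ≤ distEnt (lawOf μ (nameOf T ξ n)) := by
  have hs := subadd_ent μ T hT hT' ξ hξ
  have hb : BddBelow (range fun n : ℕ => distEnt (lawOf μ (nameOf T ξ n)) / n) :=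
    ⟨0, by rintro _ ⟨n, rfl⟩; exact div_nonneg (distEnt_nonneg μ _) (Nat.cast_nonneg _)⟩
  refine ⟨hs.lim, ?_, fun n hn => ?_⟩
  · have ht := ENNReal.tendsto_ofReal (hs.tendsto_lim hb)
    have ht2 : Tendsto (fun n : ℕ =>
      partitionEntropy μ (fun x => fun i : Fin n => ξ ((T ^ (-(i : ℤ))) x)) / (n : ℝ≥0∞))
      atTop (nhds (ENNReal.ofReal hs.lim)) := by
      refine ht.congr' ?_
      filter_upwards [eventually_ge_atTop 1] with n hn
      rw [partitionEntropy_eq, ENNReal.ofReal_div_of_pos (by exact_mod_cast hn),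
        ENNReal.ofReal_natCast]
      rfl
    rw [ht2.limsup_eq] at hpos
    exact ENNReal.ofReal_pos.1 hpos
  · have := hs.lim_le_div hb (show n ≠ 0 by omega)
    rwa [le_div_iff₀ (by exact_mod_cast hn)] at this

lemma hamming_count {m n : ℕ} (s r : ℝ) (hs : 0 < s) (hs1 : s < 1) (b : Fin n → Fin m)
    (G : Finset (Fin n → Fin m)) (hG : ∀ a ∈ G, (hammingDist a b : ℝ) ≤ r) :
    (G.card : ℝ) * s ^ r ≤ (1 + m * s) ^ n := by
  calc (G.card : ℝ) * s ^ r = ∑ a ∈ G, s ^ r := by simp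
    _ ≤ ∑ a ∈ G, s ^ (hammingDist a b) := by
        refine Finset.sum_le_sum fun a ha => ?_
        rw [← Real.rpow_natCast]
        exact Real.rpow_le_rpow_of_exponent_ge hs hs1.le (hG a ha)
    _ ≤ ∑ a, s ^ (hammingDist a b) :=
        Finset.sum_le_sum_of_subset_of_nonneg (Finset.subset_univ _) fun a _ _ => by positivity
    _ = ∑ a : Fin n → Fin m, ∏ i, (if a i ≠ b i then s else 1) := by
        refine Finset.sum_congr rfl fun a _ => ?_
        rw [Finset.prod_ite]; simp [hammingDist]
    _ = ∏ i : Fin n, ∑ α : Fin m, (if α ≠ b i then s else 1) :=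
        (Fintype.prod_sum (fun i α => if α ≠ b i then s else 1)).symm
    _ ≤ ∏ i : Fin n, (1 + m * s) := by
        refine Finset.prod_le_prod (fun i _ => Finset.sum_nonneg fun α _ => by
          split_ifs <;> positivity) fun i _ => ?_
        calc ∑ α : Fin m, (if α ≠ b i then s else 1)
            ≤ ∑ α : Fin m, ((if α = b i then 1 else 0) + s) := by
              refine Finset.sum_le_sum fun α _ => ?_
              by_cases h : α = b i <;> simp [h, hs.le]
          _ = 1 + m * s := by rw [Finset.sum_add_distrib]; simp
    _ = _ := by simp

/-- Main counting estimate. -/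
lemma lower_count {Y : Type*} [MeasurableSpace Y] {m n : ℕ} (μ : Measure Y)
    [IsProbabilityMeasure μ] (F : Y → Fin n → Fin m) (hF : Measurable F)
    (σ : Y → Y → ℝ) (hn : 1 ≤ n) (ε s : ℝ) (hε1 : ε < 1) (hε0 : 0 < ε)
    (hs : 0 < s) (hs1 : s < 1)
    (hσ : ∀ x y, (hammingDist (F x) (F y) : ℝ) ≤ n * σ x y) (k : ℕ)
    (hk : IsEntropyPartition μ σ ε k) :
    distEnt (lawOf μ F) ≤ 1 + Real.logb 2 k +
      n * (Real.logb 2 (1 + m * s) - ε * Real.logb 2 s + ε * Real.logb 2 m) := by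
  classical
  obtain ⟨P, hPm, -, hPu, hP0, hPd⟩ := hk
  let Gj : Fin k → Finset (Fin n → Fin m) := fun j =>
    Finset.univ.filter (fun a => ∃ x ∈ P j.succ, F x = a)
  let G : Finset (Fin n → Fin m) := Finset.univ.biUnion Gj
  have hcj : ∀ j, ((Gj j).card : ℝ) * s ^ ((n : ℝ) * ε) ≤ (1 + m * s) ^ n := by
    intro j
    rcases (Gj j).eq_empty_or_nonempty with h | ⟨b, hb⟩
    · rw [h]; simp; positivity
    · refine hamming_count s _ hs hs1 b _ fun a ha => ?_
      simp only [Gj, Finset.mem_filter, Finset.mem_univ, true_and] at ha hb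
      obtain ⟨x, hx, rfl⟩ := ha
      obtain ⟨y, hy, rfl⟩ := hb
      exact (hσ x y).trans (mul_le_mul_of_nonneg_left
        (hPd j.succ (Fin.succ_ne_zero j) x hx y hy).le (Nat.cast_nonneg _))
  have hsp : 0 < s ^ ((n : ℝ) * ε) := Real.rpow_pos_of_pos hs _
  have hGcard : (G.card : ℝ) * s ^ ((n : ℝ) * ε) ≤ k * (1 + m * s) ^ n := by
    have h1 : (G.card : ℝ) ≤ ∑ j, ((Gj j).card : ℝ) := by
      exact_mod_cast Finset.card_biUnion_le
    calc _ ≤ (∑ j, ((Gj j).card : ℝ)) * s ^ ((n : ℝ) * ε) := by gcongr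
      _ = ∑ j, ((Gj j).card : ℝ) * s ^ ((n : ℝ) * ε) := Finset.sum_mul ..
      _ ≤ ∑ j : Fin k, (1 + m * s) ^ n := Finset.sum_le_sum fun j _ => hcj j
      _ = _ := by simp
  have hsub : F ⁻¹' ((Gᶜ : Finset (Fin n → Fin m)) : Set (Fin n → Fin m)) ⊆ P 0 := by
    intro x hx
    have hxu : x ∈ ⋃ j, P j := by rw [hPu]; trivial
    obtain ⟨j, hj⟩ := mem_iUnion.1 hxu
    by_cases h0 : j = 0
    · rwa [h0] at hj
    · exfalso
      obtain ⟨i, rfl⟩ := Fin.exists_succ_eq.2 h0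
      refine (Finset.mem_compl.1 (show F x ∈ Gᶜ from hx)) ?_
      exact Finset.mem_biUnion.2 ⟨i, Finset.mem_univ _, by
        simp only [Gj, Finset.mem_filter, Finset.mem_univ, true_and]; exact ⟨x, hj, rfl⟩⟩
  have hFs : ∀ a, MeasurableSet (F ⁻¹' {a}) := fun a => hF (measurableSet_singleton a)
  have hsm : ∑ a ∈ Gᶜ, lawOf μ F a ≤ ε := by
    rw [sum_lawOf_finset μ F hFs]
    exact ENNReal.toReal_le_of_le_ofReal hε0.le ((measure_mono hsub).trans hP0.le)
  have hGne : G.Nonempty := by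
    by_contra h
    rw [Finset.not_nonempty_iff_eq_empty] at h
    rw [h, Finset.compl_empty, sum_lawOf μ F hFs] at hsm
    linarith
  have hmain := distEnt_le_of_set (lawOf μ F) (lawOf_nonneg μ F) (sum_lawOf μ F hFs) G hGne ε hsm
  have hGc : (0 : ℝ) < G.card := by exact_mod_cast hGne.card_pos
  have hk0 : (0 : ℝ) < k := by
    rcases Nat.eq_zero_or_pos k with h | h
    · subst h
      have := mul_pos hGc hsp
      simp at hGcard; linarith
    · exact_mod_cast h
  have h1ms : 0 < 1 + m * s := by positivity
  have hlog := Real.logb_le_logb_of_le (b := 2) (by norm_num) (mul_pos hGc hsp) hGcard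
  rw [Real.logb_mul hGc.ne' hsp.ne', Real.logb_mul hk0.ne' (by positivity),
    Real.logb_rpow_eq_mul_logb_of_pos hs, Real.logb_pow] at hlog
  have hcA : Real.logb 2 (Fintype.card (Fin n → Fin m)) = n * Real.logb 2 m := by
    simp [Real.logb_pow]
  rw [hcA] at hmain
  nlinarith

lemma isEntropyPartition_of_map {Y A : Type*} [MeasurableSpace Y] [Fintype A] (μ : Measure Y)
    (σ : Y → Y → ℝ) (ε : ℝ) (hε : 0 < ε) (F : Y → A) (hF : ∀ a, MeasurableSet (F ⁻¹' {a}))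
    (h : ∀ x y, F x = F y → σ x y < ε) : IsEntropyPartition μ σ ε (Fintype.card A) := by
  let e := Fintype.equivFin A
  refine ⟨Fin.cons ∅ (fun j => F ⁻¹' {e.symm j}), ?_, ?_, ?_, ?_, ?_⟩
  · intro j
    refine Fin.cases ?_ (fun i => ?_) j
    · simp
    · simpa using hF _
  · intro i j
    refine Fin.cases ?_ (fun i => ?_) i
    · simp
    · refine Fin.cases ?_ (fun j => ?_) j
      · simp
      · intro hij
        simp only [Fin.cons_succ]
        rw [Set.disjoint_left]
        intro x hx hy
        simp only [mem_preimage, mem_singleton_iff] at hx hy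
        exact hij (congrArg _ (e.symm.injective (hx.symm.trans hy)))
  · refine eq_univ_of_forall fun x => mem_iUnion.2 ⟨(e (F x)).succ, ?_⟩
    simp
  · simpa using hε
  · intro j
    refine Fin.cases ?_ (fun i => ?_) j
    · simp
    · intro _ x hx y hy
      simp only [Fin.cons_succ, mem_preimage, mem_singleton_iff] at hx hy
      exact h x y (hx.trans hy.symm)

lemma epsEntropy_le {Y : Type*} [MeasurableSpace Y] (μ : Measure Y)
    (σ : Y → Y → ℝ) (ε : ℝ) (k : ℕ) (hk : IsEntropyPartition μ σ ε k) (hk1 : 1 ≤ k) :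
    epsEntropy μ σ ε ≤ ENNReal.ofReal (Real.logb 2 k) := by
  classical
  have h : ∃ k, IsEntropyPartition μ σ ε k := ⟨k, hk⟩
  unfold epsEntropy
  rw [dif_pos h]
  refine ENNReal.ofReal_le_ofReal ?_
  have hle := Nat.find_min' h hk
  rcases Nat.eq_zero_or_pos (Nat.find h) with h0 | h0
  · rw [h0]; simp
    exact Real.logb_nonneg (by norm_num) (by exact_mod_cast hk1)
  · exact Real.logb_le_logb_of_le (by norm_num) (by exact_mod_cast h0) (by exact_mod_cast hle)

lemma le_epsEntropy {Y : Type*} [MeasurableSpace Y] (μ : Measure Y)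
    (σ : Y → Y → ℝ) (ε : ℝ) (c : ℝ) (h : ∀ k, IsEntropyPartition μ σ ε k → c ≤ Real.logb 2 k) :
    ENNReal.ofReal c ≤ epsEntropy μ σ ε := by
  classical
  unfold epsEntropy
  split_ifs with hk
  · exact ENNReal.ofReal_le_ofReal (h _ (Nat.find_spec hk))
  · exact le_top

lemma upper_bound {Y : Type*} [MeasurableSpace Y] (μ : Measure Y) (T : Equiv.Perm Y)
    (hT : Measurable T) (φ : Y → ℝ) (hφ : Measurable φ) (C : ℕ) (h0 : ∀ x, 0 ≤ φ x)
    (hC : ∀ x, φ x ≤ C) (ε : ℝ) (hε : 0 < ε) :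
    Filter.limsup (fun n : ℕ =>
      epsEntropy μ (avgSemimetric T (fun x y => |φ x - φ y|) n) ε / ENNReal.ofReal (n : ℝ))
      Filter.atTop < ⊤ := by
  obtain ⟨L, hL⟩ : ∃ L : ℕ, C / (ε / 2) < L := exists_nat_gt _
  have hb : ∀ x, ⌊φ x / (ε / 2)⌋₊ < L := by
    intro x
    rw [Nat.floor_lt (div_nonneg (h0 x) (by positivity))]
    exact lt_of_le_of_lt (div_le_div_of_nonneg_right (hC x) (by positivity)) hL
  let f : Y → Fin L := fun x => ⟨⌊φ x / (ε / 2)⌋₊, hb x⟩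
  have hf : Measurable f := by
    refine measurable_to_countable' fun i => ?_
    have : f ⁻¹' {i} = (fun x => ⌊φ x / (ε / 2)⌋₊) ⁻¹' {(i : ℕ)} := by
      ext x; simp [f, Fin.ext_iff]
    rw [this]
    exact (Nat.measurable_floor.comp (hφ.div_const _)) (measurableSet_singleton _)
  have hfd : ∀ x y, f x = f y → |φ x - φ y| ≤ ε / 2 := by
    intro x y hxy
    have e : ⌊φ x / (ε / 2)⌋₊ = ⌊φ y / (ε / 2)⌋₊ := congrArg Fin.val hxy
    have hp : 0 < ε / 2 := by positivity
    have a1 := Nat.floor_le (div_nonneg (h0 x) hp.le)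
    have a2 := Nat.lt_floor_add_one (φ x / (ε / 2))
    have b1 := Nat.floor_le (div_nonneg (h0 y) hp.le)
    have b2 := Nat.lt_floor_add_one (φ y / (ε / 2))
    rw [e] at a1 a2
    rw [le_div_iff₀ hp] at a1 b1
    rw [div_lt_iff₀ hp] at a2 b2
    rw [abs_le]; constructor <;> nlinarith
  refine lt_of_le_of_lt (b := ENNReal.ofReal (Real.logb 2 (L + 1 : ℕ))) ?_ ENNReal.ofReal_lt_top
  refine limsup_le_of_le (by isBoundedDefault) ?_
  filter_upwards [eventually_ge_atTop 1] with n hn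
  have hn0 : (0 : ℝ) < n := by exact_mod_cast hn
  let F : Y → Fin n → Fin (L + 1) := fun x i => (f ((T ^ (i : ℕ)) x)).castSucc
  have hF : Measurable F := measurable_pi_lambda _ fun i =>
    (measurable_of_countable (Fin.castSucc (n := L))).comp (hf.comp (by
      rw [Equiv.Perm.coe_pow]; exact hT.iterate _))
  have hP := isEntropyPartition_of_map μ (avgSemimetric T (fun x y => |φ x - φ y|) n) ε hε F
    (fun a => hF (measurableSet_singleton a)) (by
      intro x y hxy
      unfold avgSemimetric
      rw [div_lt_iff₀ hn0]
      have : ∑ k ∈ Finset.range n, |φ ((T ^ k) x) - φ ((T ^ k) y)| ≤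
          ∑ k ∈ Finset.range n, ε / 2 := by
        refine Finset.sum_le_sum fun k hk => hfd _ _ ?_
        have := congrFun hxy ⟨k, Finset.mem_range.1 hk⟩
        exact Fin.castSucc_injective _ this
      simp only [Finset.sum_const, Finset.card_range, nsmul_eq_mul] at this
      nlinarith)
  have hle := epsEntropy_le μ _ ε _ hP (by simp; exact Nat.one_le_pow _ _ (by omega))
  refine ENNReal.div_le_of_le_mul (hle.trans ?_)
  rw [← ENNReal.ofReal_mul (Real.logb_nonneg (by norm_num) (by
    push_cast; linarith [Nat.cast_nonneg (α := ℝ) L]))]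
  refine ENNReal.ofReal_le_ofReal (le_of_eq ?_)
  simp [Real.logb_pow]; ring

lemma lower_bound {Y : Type*} [MeasurableSpace Y] {m : ℕ} (μ : Measure Y)
    [IsProbabilityMeasure μ] (T : Equiv.Perm Y)
    (hT : MeasurePreserving T μ μ) (hT' : Measurable T.symm) (ξ : Y → Fin m)
    (hξ : Measurable ξ) (hm : 1 ≤ m) (c : ℝ) (hc : 0 < c)
    (hcn : ∀ n : ℕ, 1 ≤ n → c * n ≤ distEnt (lawOf μ (nameOf T ξ n)))
    (ρ : Y → Y → ℝ) (hρ0 : ∀ x y, 0 ≤ ρ x y) (hρ : ∀ x y, ξ x ≠ ξ y → 1 ≤ ρ x y) :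
    ∃ ε₀ : ℝ, 0 < ε₀ ∧ ∀ ε : ℝ, 0 < ε → ε < ε₀ →
    0 < Filter.liminf (fun n : ℕ =>
      epsEntropy μ (avgSemimetric T ρ n) ε / ENNReal.ofReal (n : ℝ)) Filter.atTop := by
  obtain ⟨s, hs, hs1, hsl⟩ : ∃ s : ℝ, 0 < s ∧ s < 1 ∧ Real.logb 2 (1 + m * s) < c / 8 := by
    have hcont : ContinuousAt (fun s : ℝ => Real.logb 2 (1 + m * s)) 0 := by
      have : ContinuousAt (fun s : ℝ => Real.log (1 + m * s)) 0 :=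
        ContinuousAt.log (by fun_prop) (by simp)
      exact this.div_const _
    have h1 : ∀ᶠ s in nhds (0 : ℝ), Real.logb 2 (1 + m * s) < c / 8 :=
      hcont.eventually_lt continuousAt_const (by simp; positivity)
    have h2 : ∀ᶠ s in nhds (0 : ℝ), s < 1 := eventually_lt_nhds (by norm_num)
    have h3 := (h1.and h2).filter_mono (nhdsWithin_le_nhds (s := Ioi 0))
    obtain ⟨s, ⟨a, b⟩, d⟩ := (h3.and self_mem_nhdsWithin).exists
    exact ⟨s, d, b, a⟩
  have hls : Real.logb 2 s ≤ 0 := Real.logb_nonpos (by norm_num) hs.le hs1.le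
  have hlm : 0 ≤ Real.logb 2 (m : ℝ) := Real.logb_nonneg (by norm_num) (by exact_mod_cast hm)
  set K : ℝ := Real.logb 2 (m : ℝ) - Real.logb 2 s + 1 with hK
  have hKp : 0 < K := by linarith
  refine ⟨min (1 / 2) (c / 8 / K), lt_min (by norm_num) (by positivity), fun ε hε hεl => ?_⟩
  have hε1 : ε < 1 := by linarith [hεl.trans_le (min_le_left _ _)]
  have hεK : ε * K < c / 8 := (lt_div_iff₀ hKp).1 (hεl.trans_le (min_le_right _ _))
  refine lt_of_lt_of_le (b := ENNReal.ofReal (c / 2)) (ENNReal.ofReal_pos.2 (by positivity)) ?_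
  refine le_liminf_of_le (by isBoundedDefault) ?_
  obtain ⟨N, hN⟩ := exists_nat_gt (4 / c)
  filter_upwards [eventually_ge_atTop 1, eventually_ge_atTop N] with n hn hnN
  have hn0 : (0 : ℝ) < n := by exact_mod_cast hn
  have hnc : 4 < n * c := by
    have : (N : ℝ) ≤ n := by exact_mod_cast hnN
    exact (div_lt_iff₀ hc).1 (hN.trans_le this)
  rw [ENNReal.le_div_iff_mul_le (Or.inl (ENNReal.ofReal_pos.2 hn0).ne') (Or.inl ENNReal.ofReal_ne_top),
    ← ENNReal.ofReal_mul (by positivity)]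
  refine le_epsEntropy μ _ ε _ fun k hk => ?_
  have mp := mp_zpow_perm μ T hT hT' ((n - 1 : ℕ) : ℤ)
  have hmn := measurable_nameOf T hT.measurable hT' ξ hξ n
  have hlaw := lawOf_comp μ (nameOf T ξ n) _ mp (fun a => hmn (measurableSet_singleton a))
  have hL := lower_count μ (fun x => nameOf T ξ n ((T ^ ((n - 1 : ℕ) : ℤ)) x))
    (hmn.comp mp.measurable) (avgSemimetric T ρ n) hn ε s hε1 hε hs hs1 (by
      intro x y
      have hF : ∀ (i : Fin n) (z : Y), nameOf T ξ n ((T ^ ((n - 1 : ℕ) : ℤ)) z) i =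
          ξ ((T ^ (n - 1 - (i : ℕ))) z) := by
        intro i z
        simp only [nameOf]
        rw [← Equiv.Perm.mul_apply, ← zpow_add, ← zpow_natCast]
        congr 3
        have := i.2
        omega
      unfold avgSemimetric
      rw [mul_div_cancel₀ _ hn0.ne', ← Finset.sum_range_reflect,
        ← Fin.sum_univ_eq_sum_range
          (fun j => ρ ((T ^ (n - 1 - j)) x) ((T ^ (n - 1 - j)) y)) n]
      unfold hammingDist
      rw [Finset.card_filter]
      push_cast
      refine Finset.sum_le_sum fun i _ => ?_
      split_ifs with h
      · rw [hF, hF] at h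
        exact hρ _ _ h
      · exact hρ0 _ _) k hk
  rw [hlaw] at hL
  have h1 := hcn n hn
  have h2 : Real.logb 2 (1 + m * s) - ε * Real.logb 2 s + ε * Real.logb 2 m ≤ c / 4 := by
    have : ε * K = ε * Real.logb 2 (m : ℝ) - ε * Real.logb 2 s + ε := by rw [hK]; ring
    linarith
  have h3 := mul_le_mul_of_nonneg_left h2 hn0.le
  nlinarith

end ScalingHelpers

/-- If the Kolmogorov entropy of an ergodic automorphism of a standard probability
space is finite and positive, then the sequence `h_n = n` is a scaling entropy sequence. -/
theorem isScalingEntropySeq_id_of_kolmogorovEntropy_pos_lt_top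
    {X : Type*} [MeasurableSpace X] [StandardBorelSpace X]
    (μ : Measure X) [IsProbabilityMeasure μ]
    (T : Equiv.Perm X) (hT : Measurable (⇑T)) (hTsymm : Measurable (⇑T.symm))
    (hTerg : Ergodic (⇑T) μ)
    (hpos : 0 < kolmogorovEntropy μ T) (hfin : kolmogorovEntropy μ T < ⊤) :
    IsScalingEntropySeq μ T (fun n => (n : ℝ)) := by
  unfold kolmogorovEntropy at hpos
  simp only [lt_iSup_iff] at hpos
  obtain ⟨m, ξ, hξ', hpos⟩ := hpos
  have hξ : Measurable ξ := measurable_to_countable' hξ'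
  have hmp : MeasurePreserving T μ μ := hTerg.toMeasurePreserving
  obtain ⟨c, hc, hcn⟩ := exists_ent_lower μ T hmp hTsymm ξ hξ hpos
  have hne : Nonempty X := μ.nonempty_of_neZero
  obtain ⟨x₀⟩ := hne
  have hm : 1 ≤ m := Nat.one_le_iff_ne_zero.2 (by rintro rfl; exact (ξ x₀).elim0)
  obtain ⟨g, hg, hgi, hg0, hg1⟩ : ∃ g : X → ℝ, Measurable g ∧ Function.Injective g ∧
      (∀ x, 0 ≤ g x) ∧ ∀ x, g x ≤ 1 := by
    have he := measurableEmbedding_embeddingReal X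
    refine ⟨fun x => Real.arctan (embeddingReal X x) / 4 + 1 / 2, ?_, ?_, ?_, ?_⟩
    · exact ((Real.measurable_arctan.comp he.measurable).div_const _).add_const _
    · intro x y h
      exact he.injective (Real.arctan_injective (by simpa using h))
    · intro x
      have := Real.neg_pi_div_two_lt_arctan (embeddingReal X x)
      linarith [Real.pi_lt_four]
    · intro x
      have := Real.arctan_lt_pi_div_two (embeddingReal X x)
      linarith [Real.pi_lt_four]
  let φ : X → ℝ := fun x => 2 * ((ξ x : ℕ) : ℝ) + g x
  have hφ : Measurable φ :=
    ((measurable_of_countable (fun i : Fin m => 2 * ((i : ℕ) : ℝ))).comp hξ).add hg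
  have hsep : ∀ x y, ξ x ≠ ξ y → 1 ≤ |φ x - φ y| := by
    have key : ∀ x y, ξ x < ξ y → 1 ≤ |φ x - φ y| := by
      intro x y h
      have h' : ((ξ x : ℕ) : ℝ) + 1 ≤ ((ξ y : ℕ) : ℝ) := by exact_mod_cast h
      rw [le_abs]; right
      simp only [φ]
      linarith [hg0 x, hg0 y, hg1 x, hg1 y]
    intro x y h
    rcases lt_or_gt_of_ne h with h | h
    · exact key x y h
    · rw [abs_sub_comm]; exact key y x h
  have hφi : Function.Injective φ := by
    intro x y h
    have : ξ x = ξ y := by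
      by_contra hne
      have := hsep x y hne
      rw [h] at this; simp at this; linarith
    simp only [φ, this] at h
    exact hgi (by linarith)
  have hφ0 : ∀ x, 0 ≤ φ x := fun x => by
    have := hg0 x; simp only [φ]; positivity
  have hφC : ∀ x, φ x ≤ (2 * m + 1 : ℕ) := fun x => by
    have h1 := hg1 x
    have h2 : ((ξ x : ℕ) : ℝ) ≤ m := by exact_mod_cast (ξ x).2.le
    simp only [φ]; push_cast; linarith
  have hmeas : Measurable (fun p : X × X => |φ p.1 - φ p.2|) := by
    have : Measurable (fun p : X × X => φ p.1 - φ p.2) :=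
      (hφ.comp measurable_fst).sub (hφ.comp measurable_snd)
    simpa [Real.norm_eq_abs] using this.norm
  refine ⟨fun x y => |φ x - φ y|, ⟨?_, ?_, ?_, ?_⟩, hmeas, ?_, ?_, ?_, ?_, ?_, ?_⟩
  · intro x; simp
  · intro x y; exact abs_sub_comm _ _
  · intro x y; exact abs_nonneg _
  · intro x y z; exact abs_sub_le _ _ _
  · refine Integrable.of_bound hmeas.aestronglyMeasurable ((2 * m + 1 : ℕ) : ℝ)
      (ae_of_all _ fun p => ?_)
    rw [Real.norm_eq_abs, abs_abs, abs_le]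
    constructor <;> linarith [hφ0 p.1, hφ0 p.2, hφC p.1, hφC p.2]
  · refine ⟨univ, MeasurableSet.univ, by simp, ?_⟩
    obtain ⟨t, hts, htc, htd⟩ := TopologicalSpace.IsSeparable.exists_countable_dense_subset
      (TopologicalSpace.IsSeparable.of_separableSpace (range φ))
    refine ⟨φ ⁻¹' t, htc.preimage hφi, subset_univ _, fun x _ ε hε => ?_⟩
    obtain ⟨b, hb, hxb⟩ := Metric.mem_closure_iff.1 (htd (mem_range_self x)) ε hε
    obtain ⟨y, rfl⟩ := hts hb
    exact ⟨y, hb, by simpa [Real.dist_eq] using hxb⟩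
  · refine ⟨univ, MeasurableSet.univ, by simp, fun x _ y _ hxy => ⟨0, ?_⟩⟩
    simpa [sub_eq_zero] using fun h => hxy (hφi h)
  · intro n hn; exact Nat.cast_pos.2 hn
  · intro ε hε
    exact upper_bound μ T hT φ hφ _ hφ0 hφC ε hε
  · exact lower_bound μ T hmp hTsymm ξ hξ hm c hc hcn _ (fun _ _ => abs_nonneg _) hsep
end
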